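/- For every natural number m ≥ 1 there exist unique monic polynomials T_1, …, T_m with rational coefficients, where T_s has degree s, such that the sum of the first n primes satisfies ∑_{k≤n} p_k = (n²/2)·(log n + log log n − 3/2 + ∑_{s=1}^{m} (−1)^{s+1}·T_s(log log n)/(s·log^s n)) + O(n²·(log log n)^{m+1}/log^{m+1} n) as n → ∞; moreover T_1(x) = x − 5/2 and T_2(x) = x² − 7x + 29/2. -/

import Mathlib

open Real Polynomial

/-- `nthPrime n` is the `n`-th prime number, with `nthPrime 1 = 2`, `nthPrime 2 = 3`, … -/
noncomputable def nthPrime (n : ℕ) : ℕ := Nat.nth Nat.Prime (n - 1)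

/-- The sum of the first `n` prime numbers, as a real number. -/
noncomputable def sumPrimes (n : ℕ) : ℝ := ∑ k ∈ Finset.Icc 1 n, (nthPrime k : ℝ)

/-- The family `T : ℕ → ℚ[X]` consists (for indices `1, …, m`) of monic polynomials with
`deg T_s = s` such that
`∑_{k≤n} p_k = (n²/2)·(log n + log log n − 3/2 + ∑_{s=1}^{m} (−1)^{s+1}·T_s(log log n)/(s·log^s n))
  + O(n²·(log log n)^{m+1}/log^{m+1} n)`. -/
def IsSumPrimesFamily (m : ℕ) (T : ℕ → Polynomial ℚ) : Prop :=
  (∀ s ∈ Finset.Icc 1 m, (T s).Monic ∧ (T s).natDegree = s) ∧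
  ∃ C : ℝ, 0 < C ∧ ∃ N : ℕ, ∀ n : ℕ, N ≤ n →
    |sumPrimes n -
        (n : ℝ) ^ 2 / 2 * (Real.log n + Real.log (Real.log n) - 3 / 2 +
          ∑ s ∈ Finset.Icc 1 m, (-1 : ℝ) ^ (s + 1) *
            (Polynomial.aeval (Real.log (Real.log n)) (T s)) /
              ((s : ℝ) * Real.log n ^ s))| ≤
      C * (n : ℝ) ^ 2 * Real.log (Real.log n) ^ (m + 1) / Real.log n ^ (m + 1)

section PartPA1

open Real

namespace PNT

/-- tail integral of the fractional part -/
noncomputable def fracInt (N : ℕ) (s : ℂ) : ℂ :=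
  ∫ x : ℝ in Set.Ioi (N : ℝ), ((Int.fract x : ℝ) : ℂ) * (x : ℂ) ^ (-(s + 1))

lemma fracInt_eq_mellin (N : ℕ) (s : ℂ) :
    fracInt N s = mellin (Set.indicator (Set.Ioi (N : ℝ)) (fun x : ℝ => ((Int.fract x : ℝ) : ℂ))) (-s) := by
  unfold fracInt mellin
  have : ∀ t : ℝ, (t : ℂ) ^ (-s - 1) • Set.indicator (Set.Ioi (N : ℝ)) (fun x : ℝ => ((Int.fract x : ℝ) : ℂ)) t
      = Set.indicator (Set.Ioi (N : ℝ)) (fun x : ℝ => ((Int.fract x : ℝ) : ℂ) * (x : ℂ) ^ (-(s + 1))) t := by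
    intro t
    by_cases h : t ∈ Set.Ioi (N : ℝ)
    · simp only [Set.indicator_of_mem h, smul_eq_mul]
      rw [mul_comm, neg_add']
    · simp [Set.indicator_of_notMem h]
  simp_rw [this]
  rw [MeasureTheory.setIntegral_indicator measurableSet_Ioi]
  congr 2
  ext x
  simp only [Set.mem_Ioi, Set.mem_inter_iff]
  have : (0 : ℝ) ≤ N := Nat.cast_nonneg N
  constructor
  · intro h; exact ⟨by linarith, h⟩
  · intro h; exact h.2

lemma measurable_fractC : Measurable (fun x : ℝ => ((Int.fract x : ℝ) : ℂ)) :=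
  Complex.measurable_ofReal.comp measurable_fract

lemma norm_fractC_le (x : ℝ) : ‖((Int.fract x : ℝ) : ℂ)‖ ≤ 1 := by
  rw [Complex.norm_real, Real.norm_of_nonneg (Int.fract_nonneg x)]
  exact (Int.fract_lt_one x).le

lemma differentiableAt_fracInt (N : ℕ) (hN : 1 ≤ N) {s : ℂ} (hs : 0 < s.re) :
    DifferentiableAt ℂ (fracInt N) s := by
  have h1 : fracInt N = fun s => mellin (Set.indicator (Set.Ioi (N : ℝ)) (fun x : ℝ => ((Int.fract x : ℝ) : ℂ))) (-s) := by
    funext s; exact fracInt_eq_mellin N s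
  rw [h1]
  have h2 : DifferentiableAt ℂ (mellin (Set.indicator (Set.Ioi (N : ℝ)) (fun x : ℝ => ((Int.fract x : ℝ) : ℂ)))) (-s) := by
    apply mellin_differentiableAt_of_isBigO_rpow (a := 0) (b := -s.re - 1)
    · apply MeasureTheory.LocallyIntegrable.locallyIntegrableOn
      apply MeasureTheory.LocallyIntegrable.indicator _ measurableSet_Ioi
      apply MeasureTheory.LocallyIntegrable.mono (MeasureTheory.locallyIntegrable_const (1:ℂ)) measurable_fractC.aestronglyMeasurable
      filter_upwards with x
      simpa using norm_fractC_le x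
    · apply Asymptotics.IsBigO.of_bound 1
      filter_upwards with x
      simp only [neg_zero, rpow_zero, norm_one, mul_one]
      refine (norm_indicator_le_norm_self _ _).trans (norm_fractC_le x) 
    · simpa using hs
    · have : (Set.indicator (Set.Ioi (N : ℝ)) (fun x : ℝ => ((Int.fract x : ℝ) : ℂ))) =ᶠ[nhdsWithin 0 (Set.Ioi 0)] fun _ => 0 := by
        apply Filter.Eventually.filter_mono nhdsWithin_le_nhds
        have : Set.Iio (1:ℝ) ∈ nhds (0:ℝ) := Iio_mem_nhds (by norm_num)
        filter_upwards [this] with x hx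
        apply Set.indicator_of_notMem
        simp only [Set.mem_Ioi, not_lt]
        have : (1:ℝ) ≤ N := by exact_mod_cast hN
        exact (le_of_lt hx).trans this
      exact this.trans_isBigO (Asymptotics.isBigO_zero _ _)
    · simp
  exact h2.comp s differentiableAt_id.neg

lemma norm_fracInt_le (N : ℕ) (hN : 1 ≤ N) {s : ℂ} (hs : 0 < s.re) :
    ‖fracInt N s‖ ≤ (N : ℝ) ^ (-s.re) / s.re := by
  have hN' : (0:ℝ) < N := by exact_mod_cast hN
  unfold fracInt
  have h : ∫ x : ℝ in Set.Ioi (N : ℝ), x ^ (-(s.re + 1)) = (N : ℝ) ^ (-s.re) / s.re := by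
    rw [integral_Ioi_rpow_of_lt (by linarith) hN']
    rw [show -(s.re + 1) + 1 = -s.re by ring, neg_div_neg_eq]
  rw [← h]
  apply MeasureTheory.norm_integral_le_of_norm_le
  · exact integrableOn_Ioi_rpow_of_lt (by linarith) hN'
  · filter_upwards [MeasureTheory.ae_restrict_mem measurableSet_Ioi] with x hx
    have hx0 : 0 < x := hN'.trans hx
    rw [norm_mul, Complex.norm_cpow_eq_rpow_re_of_pos hx0]
    have := norm_fractC_le x
    have h2 : 0 ≤ x ^ ((-(s + 1)).re) := by positivity
    calc _ ≤ 1 * x ^ ((-(s + 1)).re) := by gcongr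
      _ = _ := by simp

lemma integrable_fracInt (N : ℕ) (hN : 1 ≤ N) {s : ℂ} (hs : 0 < s.re) :
    MeasureTheory.IntegrableOn (fun x : ℝ => ((Int.fract x : ℝ) : ℂ) * (x : ℂ) ^ (-(s + 1))) (Set.Ioi (N:ℝ)) := by
  have hN' : (0:ℝ) < N := by exact_mod_cast hN
  have hc : MeasureTheory.IntegrableOn (fun x : ℝ => (x : ℂ) ^ (-(s + 1))) (Set.Ioi (N:ℝ)) :=
    integrableOn_Ioi_cpow_of_lt (by simp; linarith) hN'
  apply MeasureTheory.Integrable.bdd_mul (c := 1) hc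
  · exact measurable_fractC.aestronglyMeasurable
  · filter_upwards with x using norm_fractC_le x

/-- The truncated representation on `Re s > 1`. -/
lemma zeta_rep (N : ℕ) (hN : 1 ≤ N) {s : ℂ} (hs : 1 < s.re) :
    riemannZeta s = ∑ n ∈ Finset.Icc 1 N, (n : ℂ) ^ (-s) + (N : ℂ) ^ (1 - s) / (s - 1)
      - s * fracInt N s := by
  have hN' : (0:ℝ) < N := by exact_mod_cast hN
  have hs0 : s ≠ 0 := by rintro rfl; simp at hs; linarith
  have hs1 : s - 1 ≠ 0 := by
    intro h; rw [sub_eq_zero] at h; rw [h] at hs; simp at hs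
  set f : ℕ → ℂ := fun n => if N < n then 1 else 0 with hf
  have hcount : ∀ m : ℕ, ∑ k ∈ Finset.Icc 1 m, f k = ((m - N : ℕ) : ℂ) := by
    intro m
    simp only [hf, Finset.sum_ite, Finset.sum_const_zero, add_zero, Finset.sum_const, nsmul_eq_mul, mul_one]
    congr 1
    have : Finset.filter (fun x => N < x) (Finset.Icc 1 m) = Finset.Ioc N m := by
      ext x; simp; omega
    rw [this, Nat.card_Ioc]
  have hsumm : LSeriesSummable f s := by
    apply LSeriesSummable_of_bounded_of_one_lt_re (m := 1) _ hs
    intro n _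
    simp only [hf]; split_ifs <;> simp
  have hL := LSeries_eq_mul_integral f (r := 1) zero_le_one hs hsumm (by
    apply Asymptotics.IsBigO.of_bound 1
    filter_upwards with n
    rw [hcount]
    simp only [rpow_one, one_mul, Complex.norm_natCast, Real.norm_natCast]
    exact_mod_cast Nat.sub_le n N)
  -- left side
  have hleft : LSeries f s = riemannZeta s - ∑ n ∈ Finset.Icc 1 N, (n : ℂ) ^ (-s) := by
    have hz : riemannZeta s = LSeries 1 s := (LSeries_one_eq_riemannZeta hs).symm
    set g : ℕ → ℂ := fun n => if n ≤ N then 1 else 0 with hg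
    have h1 : (1 : ℕ → ℂ) = f + g := by
      funext n; simp only [hf, hg, Pi.add_apply, Pi.one_apply]
      by_cases h : N < n
      · simp [h]
      · simp [h, not_lt.mp h]
    have hgs : LSeriesSummable g s := by
      apply LSeriesSummable_of_bounded_of_one_lt_re (m := 1) _ hs
      intro n _
      simp only [hg]; split_ifs <;> simp
    have hgL : LSeries g s = ∑ n ∈ Finset.Icc 1 N, (n : ℂ) ^ (-s) := by
      unfold LSeries
      rw [tsum_eq_sum (s := Finset.Icc 1 N)]
      · apply Finset.sum_congr rfl
        intro n hn
        rw [Finset.mem_Icc] at hn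
        rw [LSeries.term_of_ne_zero (by omega)]
        simp [hg, hn.2, Complex.cpow_neg]
      · intro n hn
        rw [Finset.mem_Icc] at hn
        by_cases h0 : n = 0
        · simp [h0]
        · rw [LSeries.term_of_ne_zero h0]
          have : ¬ n ≤ N := by omega
          simp [hg, this]
    rw [hz, h1, LSeries_add hsumm hgs, hgL]; ring
  have hA : MeasureTheory.IntegrableOn (fun x : ℝ => (x : ℂ) ^ (-s)) (Set.Ioi (N:ℝ)) :=
    integrableOn_Ioi_cpow_of_lt (by simp; linarith) hN'
  have hB : MeasureTheory.IntegrableOn (fun x : ℝ => (x : ℂ) ^ (-(s+1))) (Set.Ioi (N:ℝ)) :=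
    integrableOn_Ioi_cpow_of_lt (by simp; linarith) hN'
  have hC := integrable_fracInt N hN (s := s) (by linarith)
  have hright : ∫ t : ℝ in Set.Ioi 1, (∑ k ∈ Finset.Icc 1 ⌊t⌋₊, f k) * (t:ℂ) ^ (-(s + 1)) =
      (N:ℂ) ^ (1 - s) / (s - 1) - (N:ℂ) * ((N:ℂ) ^ (- s) / s) - fracInt N s := by
    have e1 : ∫ t : ℝ in Set.Ioi 1, (∑ k ∈ Finset.Icc 1 ⌊t⌋₊, f k) * (t:ℂ) ^ (-(s + 1)) =
        ∫ t : ℝ in Set.Ioi (N:ℝ), (∑ k ∈ Finset.Icc 1 ⌊t⌋₊, f k) * (t:ℂ) ^ (-(s + 1)) := by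
      apply MeasureTheory.setIntegral_eq_of_subset_of_forall_sdiff_eq_zero measurableSet_Ioi
      · apply Set.Ioi_subset_Ioi; exact_mod_cast hN
      · intro x hx
        simp only [Set.mem_sdiff, Set.mem_Ioi, not_lt] at hx
        rw [hcount]
        have : ⌊x⌋₊ ≤ N := by
          have := Nat.floor_le_floor hx.2
          simpa using this
        rw [Nat.sub_eq_zero_of_le this]; simp
    rw [e1]
    have e2 : ∫ t : ℝ in Set.Ioi (N:ℝ), (∑ k ∈ Finset.Icc 1 ⌊t⌋₊, f k) * (t:ℂ) ^ (-(s + 1)) =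
        ∫ t : ℝ in Set.Ioi (N:ℝ), ((t:ℂ) ^ (-s) - (N:ℂ) * (t:ℂ) ^ (-(s+1)) - ((Int.fract t : ℝ) : ℂ) * (t : ℂ) ^ (-(s + 1))) := by
      apply MeasureTheory.setIntegral_congr_fun measurableSet_Ioi
      intro t ht
      have ht0 : 0 < t := hN'.trans ht
      have htN : N ≤ ⌊t⌋₊ := Nat.le_floor (le_of_lt ht)
      simp only
      rw [hcount, Nat.cast_sub htN]
      have h3 : ((⌊t⌋₊ : ℕ) : ℂ) = (t:ℂ) - ((Int.fract t : ℝ) : ℂ) := by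
        have : ((⌊t⌋₊ : ℕ) : ℝ) = t - Int.fract t := by
          rw [natCast_floor_eq_intCast_floor ht0.le, Int.self_sub_fract]
        exact_mod_cast congrArg (fun x : ℝ => (x:ℂ)) this
      have h4 : (t:ℂ) ^ (-s) = (t:ℂ) * (t:ℂ) ^ (-(s+1)) := by
        rw [show -s = 1 + -(s+1) by ring, Complex.cpow_add _ _ (by exact_mod_cast ht0.ne'), Complex.cpow_one]
      rw [h3, h4]; ring
    have hAB : MeasureTheory.IntegrableOn (fun x : ℝ => (x : ℂ) ^ (-s) - (N:ℂ) * (x : ℂ) ^ (-(s+1))) (Set.Ioi (N:ℝ)) :=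
      hA.sub (hB.const_mul _)
    rw [e2, MeasureTheory.integral_sub hAB hC, MeasureTheory.integral_sub hA (hB.const_mul _),
      MeasureTheory.integral_const_mul, integral_Ioi_cpow_of_lt (by simp; linarith) hN', integral_Ioi_cpow_of_lt (by simp; linarith) hN']
    unfold fracInt
    rw [show -s + 1 = -(s-1) by ring, show -(s+1)+1 = -s by ring, neg_div_neg_eq, neg_div_neg_eq, show -(s-1) = 1 - s by ring]
    simp
  rw [hleft, hright] at hL
  have h5 : (N:ℂ) * (N:ℂ) ^ (- s) = (N:ℂ) ^ (1 - s) := by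
    rw [sub_eq_add_neg, Complex.cpow_add _ _ (by exact_mod_cast hN'.ne'), Complex.cpow_one]
  have h6 : s * ((N:ℂ) * ((N:ℂ) ^ (- s) / s)) = (N:ℂ) ^ (1 - s) := by
    rw [← h5]; field_simp
  have h7 : s * ((N:ℂ) ^ (1 - s) / (s - 1)) = (N:ℂ) ^ (1 - s) + (N:ℂ) ^ (1 - s) / (s - 1) := by
    field_simp; ring
  linear_combination hL + h7 - h6

/-- The representation of `(s-1) ζ(s)` on `Re s > 0`. -/
lemma zeta₁_rep (N : ℕ) (hN : 1 ≤ N) {s : ℂ} (hs : 0 < s.re) :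
    riemannZeta₁ s = (s - 1) * ∑ n ∈ Finset.Icc 1 N, (n : ℂ) ^ (-s) + (N : ℂ) ^ (1 - s)
      - s * (s - 1) * fracInt N s := by
  have hN' : (0:ℝ) < N := by exact_mod_cast hN
  set U : Set ℂ := {s | 0 < s.re} with hU
  have hUo : IsOpen U := isOpen_lt continuous_const Complex.continuous_re
  have hf : AnalyticOnNhd ℂ riemannZeta₁ U :=
    (differentiable_riemannZeta₁.differentiableOn).analyticOnNhd hUo
  have hg : AnalyticOnNhd ℂ (fun s => (s - 1) * ∑ n ∈ Finset.Icc 1 N, (n : ℂ) ^ (-s) + (N : ℂ) ^ (1 - s)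
      - s * (s - 1) * fracInt N s) U := by
    apply DifferentiableOn.analyticOnNhd _ hUo
    intro z hz
    apply DifferentiableAt.differentiableWithinAt
    have h1 := differentiableAt_fracInt N hN hz
    have h2 : DifferentiableAt ℂ (fun s : ℂ => ∑ n ∈ Finset.Icc 1 N, (n : ℂ) ^ (-s)) z := by
      apply DifferentiableAt.fun_sum
      intro n hn
      rw [Finset.mem_Icc] at hn
      apply DifferentiableAt.const_cpow (by fun_prop)
      left; exact_mod_cast (by omega : n ≠ 0)
    have h3 : DifferentiableAt ℂ (fun s : ℂ => (N : ℂ) ^ (1 - s)) z := by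
      apply DifferentiableAt.const_cpow (by fun_prop)
      left; exact_mod_cast (by omega : N ≠ 0)
    fun_prop
  have hpre : IsPreconnected U := (convex_halfSpace_re_gt 0).isPreconnected
  have h2U : (2:ℂ) ∈ U := by simp [hU]
  refine hf.eqOn_of_preconnected_of_eventuallyEq hg hpre h2U ?_ hs
  have : {s : ℂ | 1 < s.re} ∈ nhds (2:ℂ) :=
    (isOpen_lt continuous_const Complex.continuous_re).mem_nhds (by simp)
  filter_upwards [this] with z hz
  have hz1 : z - 1 ≠ 0 := by
    intro h; rw [sub_eq_zero] at h; rw [h] at hz; simp at hz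
  have h1 := zeta_rep N hN hz
  rw [riemannZeta_eq_inv_sub_mul (sub_ne_zero.mp hz1)] at h1
  field_simp at h1
  rw [h1]

end PNT

end PartPA1

section PartPA2

open Real

namespace PNT

/-- the weight `2 + |Im s|` -/
noncomputable def wt (s : ℂ) : ℝ := 2 + |s.im|

lemma two_le_wt (s : ℂ) : 2 ≤ wt s := by unfold wt; linarith [abs_nonneg s.im]
lemma wt_pos (s : ℂ) : 0 < wt s := by linarith [two_le_wt s]
lemma one_le_wt (s : ℂ) : 1 ≤ wt s := by linarith [two_le_wt s]

lemma wt_le_of_dist {s w : ℂ} {r : ℝ} (hr : r ≤ 1) (h : ‖w - s‖ ≤ r) : wt w ≤ 2 * wt s := by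
  have h1 : |w.im - s.im| ≤ 1 := by
    have := Complex.abs_im_le_norm (w - s)
    rw [Complex.sub_im] at this
    linarith
  have h2 : |w.im| ≤ |s.im| + 1 := by
    have := abs_sub_abs_le_abs_sub w.im s.im
    linarith
  unfold wt
  linarith [abs_nonneg s.im]

lemma Z_upper (ε : ℝ) (h0 : 0 < ε) (h1 : ε ≤ 1/4) : ∃ C : ℝ, 0 < C ∧ ∀ s : ℂ, 1 - ε ≤ s.re → s.re ≤ 3 →
    ‖riemannZeta₁ s‖ ≤ C * wt s ^ (1 + 2 * ε) := by
  refine ⟨2 * (6 + 1/ε), by positivity, fun s hs hs3 => ?_⟩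
  set t := wt s with ht
  have ht2 : 2 ≤ t := two_le_wt s
  have ht0 : 0 < t := by linarith
  set N : ℕ := ⌈t⌉₊ with hN
  have hNt : t ≤ N := Nat.le_ceil t
  have hN2 : (N:ℝ) ≤ 2 * t := by
    have := Nat.ceil_lt_add_one ht0.le
    rw [← hN] at this; linarith
  have hN1' : (1:ℝ) ≤ N := by linarith
  have hN1 : 1 ≤ N := by exact_mod_cast hN1'
  have hN0 : (0:ℝ) < N := by linarith
  have hre : 0 < s.re := by linarith
  rw [zeta₁_rep N hN1 hre]
  have hreabs : |s.re - 1| ≤ 2 := by rw [abs_le]; constructor <;> linarith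
  have b1 : ‖s - 1‖ ≤ t := by
    have := Complex.norm_le_abs_re_add_abs_im (s - 1)
    simp only [Complex.sub_re, Complex.one_re, Complex.sub_im, Complex.one_im, sub_zero] at this
    rw [ht, wt]; linarith
  have b2 : ‖s‖ ≤ 2 * t := by
    have : ‖s‖ ≤ ‖s - 1‖ + ‖(1:ℂ)‖ := by simpa using norm_add_le (s-1) 1
    rw [norm_one] at this; linarith
  have hNe : (1:ℝ) ≤ (N:ℝ) ^ ε := Real.one_le_rpow hN1' h0.le
  have hNe0 : (0:ℝ) < (N:ℝ) ^ ε := by positivity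
  have b3 : ‖∑ n ∈ Finset.Icc 1 N, (n : ℂ) ^ (-s)‖ ≤ (N:ℝ)^ε * (1 + (N:ℝ)^ε / ε) := by
    calc ‖∑ n ∈ Finset.Icc 1 N, (n : ℂ) ^ (-s)‖ ≤ ∑ n ∈ Finset.Icc 1 N, (N:ℝ)^ε * ((n:ℝ)⁻¹) := by
          apply norm_sum_le_of_le
          intro n hn
          rw [Finset.mem_Icc] at hn
          have hn0 : (0:ℝ) < n := by exact_mod_cast hn.1
          rw [Complex.norm_natCast_cpow_of_pos hn.1]
          have hn1 : (1:ℝ) ≤ n := by exact_mod_cast hn.1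
          have hnN : (n:ℝ) ≤ N := by exact_mod_cast hn.2
          calc (n:ℝ) ^ ((-s).re) ≤ (n:ℝ) ^ (ε + (-1)) := by
                apply Real.rpow_le_rpow_of_exponent_le hn1
                simp; linarith
            _ = (n:ℝ)^ε * (n:ℝ)⁻¹ := by rw [Real.rpow_add hn0, Real.rpow_neg_one]
            _ ≤ _ := by gcongr
      _ = (N:ℝ)^ε * ∑ n ∈ Finset.Icc 1 N, ((n:ℝ)⁻¹) := by rw [Finset.mul_sum]
      _ ≤ (N:ℝ)^ε * (1 + (N:ℝ)^ε / ε) := by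
          gcongr
          have := harmonic_le_one_add_log N
          rw [harmonic_eq_sum_Icc] at this
          push_cast at this
          exact this.trans (by gcongr; exact Real.log_le_rpow_div hN0.le h0)
  have b4 : ‖(N : ℂ) ^ (1 - s)‖ ≤ (N:ℝ)^ε := by
    rw [Complex.norm_natCast_cpow_of_pos hN1]
    apply Real.rpow_le_rpow_of_exponent_le hN1'
    simp; linarith
  have b5 : ‖fracInt N s‖ ≤ 2 * t⁻¹ * (N:ℝ)^ε := by
    refine (norm_fracInt_le N hN1 hre).trans ?_
    have : (N:ℝ) ^ (-s.re) ≤ t⁻¹ * (N:ℝ)^ε := by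
      calc (N:ℝ) ^ (-s.re) ≤ (N:ℝ) ^ (-1 + ε) := by
            apply Real.rpow_le_rpow_of_exponent_le hN1'; linarith
        _ = (N:ℝ)⁻¹ * (N:ℝ)^ε := by rw [Real.rpow_add hN0, Real.rpow_neg_one]
        _ ≤ _ := by gcongr
    rw [div_le_iff₀ hre]
    have h3 : 0 < t⁻¹ * (N:ℝ)^ε := by positivity
    nlinarith
  have b6 : (N:ℝ)^ε * (N:ℝ)^ε ≤ 2 * t ^ (2 * ε) := by
    rw [← Real.rpow_add hN0, ← two_mul]
    calc (N:ℝ) ^ (2 * ε) ≤ (2 * t) ^ (2 * ε) := by gcongr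
      _ = 2 ^ (2 * ε) * t ^ (2 * ε) := by rw [Real.mul_rpow (by norm_num) ht0.le]
      _ ≤ 2 ^ (1:ℝ) * t ^ (2 * ε) := by
          gcongr
          · norm_num
          · linarith
      _ = _ := by rw [Real.rpow_one]
  set A := (N:ℝ)^ε with hA
  have hAA : A ≤ A * A := by nlinarith
  calc ‖(s - 1) * ∑ n ∈ Finset.Icc 1 N, (n : ℂ) ^ (-s) + (N : ℂ) ^ (1 - s) - s * (s - 1) * fracInt N s‖
      ≤ ‖s - 1‖ * ‖∑ n ∈ Finset.Icc 1 N, (n : ℂ) ^ (-s)‖ + ‖(N : ℂ) ^ (1 - s)‖ + ‖s‖ * ‖s - 1‖ * ‖fracInt N s‖ := by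
        refine (norm_sub_le _ _).trans ?_
        gcongr
        · refine (norm_add_le _ _).trans ?_
          rw [norm_mul]
        · rw [norm_mul, norm_mul]
    _ ≤ t * (A * (1 + A / ε)) + A + (2 * t) * t * (2 * t⁻¹ * A) := by gcongr
    _ = t * (A + A * A * (1/ε)) + A + t * (4 * A) := by field_simp; ring
    _ ≤ t * (A * A + A * A * (1/ε)) + t * (A * A) + t * (4 * (A * A)) := by
        gcongr
        nlinarith
    _ = t * (6 + 1/ε) * (A * A) := by ring
    _ ≤ t * (6 + 1/ε) * (2 * t ^ (2 * ε)) := by gcongr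
    _ = 2 * (6 + 1/ε) * (t ^ (1:ℝ) * t ^ (2 * ε)) := by rw [Real.rpow_one]; ring
    _ = _ := by rw [← Real.rpow_add ht0]

lemma two_mul_rpow_le {t : ℝ} (ht : 0 < t) {ε : ℝ} (h1 : ε ≤ 1/4) :
    (2 * t) ^ (1 + 2 * ε) ≤ 4 * t ^ (1 + 2 * ε) := by
  rw [Real.mul_rpow (by norm_num) ht.le]
  gcongr
  calc (2:ℝ) ^ (1 + 2 * ε) ≤ 2 ^ (2:ℝ) := by
        apply Real.rpow_le_rpow_of_exponent_le (by norm_num); linarith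
    _ = 4 := by norm_num

lemma abs_re_sub_le {s w : ℂ} {r : ℝ} (h : ‖w - s‖ ≤ r) : |w.re - s.re| ≤ r := by
  have := Complex.abs_re_le_norm (w - s)
  rw [Complex.sub_re] at this
  linarith

lemma Z_deriv (ε : ℝ) (h0 : 0 < ε) (h1 : ε ≤ 1/4) : ∃ C : ℝ, 0 < C ∧ ∀ s : ℂ, 1 - ε / 2 ≤ s.re → s.re ≤ 5 / 2 →
    ‖deriv riemannZeta₁ s‖ ≤ C * wt s ^ (1 + 2 * ε) := by
  obtain ⟨C, hC, hb⟩ := Z_upper ε h0 h1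
  refine ⟨C * 4 / (ε / 2), by positivity, fun s hs hs3 => ?_⟩
  have := Complex.norm_deriv_le_of_forall_mem_sphere_norm_le (c := s) (R := ε / 2) (C := C * (4 * wt s ^ (1 + 2 * ε)))
    (f := riemannZeta₁) (by positivity) (differentiable_riemannZeta₁.diffContOnCl) (by
      intro w hw
      rw [mem_sphere_iff_norm] at hw
      have h3 := abs_le.mp (abs_re_sub_le hw.le)
      refine (hb w (by linarith) (by linarith)).trans ?_
      gcongr
      refine le_trans ?_ (two_mul_rpow_le (wt_pos s) h1)
      gcongr
      · exact (wt_pos w).le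
      · exact wt_le_of_dist (by linarith) hw.le)
  refine this.trans (le_of_eq ?_)
  ring

/-- difference bound -/
lemma Z_lip (ε : ℝ) (h0 : 0 < ε) (h1 : ε ≤ 1/4) : ∃ D : ℝ, 0 < D ∧ ∀ s w : ℂ, 1 ≤ s.re → s.re ≤ 2 →
    ‖w - s‖ ≤ ε / 2 → ‖riemannZeta₁ w - riemannZeta₁ s‖ ≤ D * wt s ^ (1 + 2 * ε) * ‖w - s‖ ∧
      ‖deriv riemannZeta₁ w‖ ≤ D * wt s ^ (1 + 2 * ε) := by
  obtain ⟨C, hC, hb⟩ := Z_deriv ε h0 h1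
  have key : ∀ s w : ℂ, 1 ≤ s.re → s.re ≤ 2 → ‖w - s‖ ≤ ε / 2 → 
      ‖deriv riemannZeta₁ w‖ ≤ C * 4 * wt s ^ (1 + 2 * ε) := by
    intro s w hs hs2 hw
    have h3 := abs_le.mp (abs_re_sub_le hw)
    refine (hb w (by linarith) (by linarith)).trans ?_
    rw [mul_assoc]
    gcongr
    refine le_trans ?_ (two_mul_rpow_le (wt_pos s) h1)
    gcongr
    · exact (wt_pos w).le
    · exact wt_le_of_dist (by linarith) hw
  refine ⟨C * 4, by positivity, fun s w hs hs2 hw => ⟨?_, key s w hs hs2 hw⟩⟩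
  apply (convex_closedBall s (ε/2)).norm_image_sub_le_of_norm_deriv_le (f := riemannZeta₁)
  · intro x _; exact differentiable_riemannZeta₁ x
  · intro x hx
    rw [mem_closedBall_iff_norm] at hx
    exact key s x hs hs2 hx
  · simp; positivity
  · rwa [mem_closedBall_iff_norm]

lemma Z_ne_zero {s : ℂ} (hs : 1 ≤ s.re) : riemannZeta₁ s ≠ 0 := by
  by_cases h : s = 1
  · rw [h, riemannZeta₁_one]; exact one_ne_zero
  · have := riemannZeta_ne_zero_of_one_le_re hs
    rw [riemannZeta_eq_inv_sub_mul h] at this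
    exact right_ne_zero_of_mul this

lemma Z_341 {x : ℝ} (hx : 0 < x) (y : ℝ) : 
    x ^ 3 * ‖(x:ℂ) + Complex.I * y‖ ^ 4 * ‖(x:ℂ) + 2 * Complex.I * y‖ ≤ 
    ‖riemannZeta₁ (1 + x)‖ ^ 3 * ‖riemannZeta₁ (1 + x + Complex.I * y)‖ ^ 4 * 
      ‖riemannZeta₁ (1 + x + 2 * Complex.I * y)‖ := by
  have h := DirichletCharacter.norm_LFunction_product_ge_one (1 : DirichletCharacter ℂ 1) hx y
  unfold DirichletCharacter.LFunctionTrivChar at h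
  rw [one_pow, DirichletCharacter.LFunction_modOne_eq] at h
  have hre : ∀ z : ℂ, 0 < z.re → (1:ℂ) + z ≠ 1 := by
    intro z hz h; 
    have : z = 0 := by simpa using h
    rw [this] at hz; simp at hz
  have n1 : (x:ℂ) ≠ 0 := by exact_mod_cast hx.ne'
  have r2 : 0 < ((x:ℂ) + Complex.I * y).re := by simpa using hx
  have r3 : 0 < ((x:ℂ) + 2 * Complex.I * y).re := by simpa using hx
  have n2 : (x:ℂ) + Complex.I * y ≠ 0 := by intro h; rw [h] at r2; simp at r2
  have n3 : (x:ℂ) + 2 * Complex.I * y ≠ 0 := by intro h; rw [h] at r3; simp at r3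
  rw [add_assoc, add_assoc, riemannZeta_eq_inv_sub_mul (hre _ (by simpa using hx)), riemannZeta_eq_inv_sub_mul (hre _ r2),
    riemannZeta_eq_inv_sub_mul (hre _ r3)] at h
  simp only [add_sub_cancel_left, norm_mul, norm_pow, norm_inv] at h
  rw [add_assoc, add_assoc]
  have e1 : ‖(x:ℂ)‖ = x := by rw [Complex.norm_real, Real.norm_of_nonneg hx.le]
  rw [e1] at h
  have p2 := norm_pos_iff.mpr n2
  have p3 := norm_pos_iff.mpr n3
  set P2 := ‖(x:ℂ) + Complex.I * y‖
  set P3 := ‖(x:ℂ) + 2 * Complex.I * y‖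
  have : x ^ 3 * P2 ^ 4 * P3 * 1 ≤ x ^ 3 * P2 ^ 4 * P3 * ((x⁻¹ * ‖riemannZeta₁ (1 + x)‖) ^ 3 * (P2⁻¹ * ‖riemannZeta₁ (1 + (x + Complex.I * y))‖) ^ 4 * 
      (P3⁻¹ * ‖riemannZeta₁ (1 + (x + 2 * Complex.I * y))‖)) := by gcongr
  rw [mul_one] at this
  refine this.trans (le_of_eq ?_)
  field_simp

end PNT

end PartPA2

section PartPA3

open Real

namespace PNT

/-- 3-4-1 consequence, fourth power form -/
lemma Z_lower4 (ε : ℝ) (h0 : 0 < ε) (h1 : ε ≤ 1/4) : ∃ c : ℝ, 0 < c ∧ ∀ s : ℂ, 1 < s.re → s.re ≤ 2 → 1 ≤ |s.im| →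
    c ^ 4 * (s.re - 1) ^ 3 * wt s ^ (4 - 2 * ε) ≤ ‖riemannZeta₁ s‖ ^ 4 := by
  obtain ⟨C, hC, hb⟩ := Z_upper ε h0 h1
  set A : ℝ := C * 2 ^ (1 + 2 * ε) with hA
  have hA0 : 0 < A := by positivity
  set c4 : ℝ := 1 / (243 * A ^ 3 * (4 * C)) with hc4
  have hc40 : 0 < c4 := by positivity
  refine ⟨c4 ^ (1/4 : ℝ), by positivity, fun s hs hs2 ht => ?_⟩
  have e4 : (c4 ^ (1/4 : ℝ)) ^ 4 = c4 := by
    rw [← Real.rpow_natCast, ← Real.rpow_mul hc40.le]; norm_num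
  rw [e4]
  set x := s.re - 1 with hx
  have hx0 : 0 < x := by linarith
  have h := Z_341 hx0 s.im
  have hs' : (1:ℂ) + x + Complex.I * s.im = s := by
    apply Complex.ext <;> simp [hx]
  rw [hs'] at h
  have u1 : ‖riemannZeta₁ (1 + x)‖ ≤ A := by
    refine (hb _ (by simp; linarith) (by simp; linarith)).trans (le_of_eq ?_)
    simp [wt, hA]
  have u3 : ‖riemannZeta₁ (1 + x + 2 * Complex.I * s.im)‖ ≤ C * (4 * wt s ^ (1 + 2 * ε)) := by
    refine (hb _ (by simp; linarith) (by simp; linarith)).trans ?_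
    gcongr
    refine le_trans ?_ (two_mul_rpow_le (wt_pos s) h1)
    gcongr
    · exact (wt_pos _).le
    · simp only [wt, Complex.add_im, Complex.one_im, Complex.ofReal_im, Complex.mul_im, Complex.mul_re]
      simp [abs_mul]
      linarith
  have l2 : |s.im| ≤ ‖(x:ℂ) + Complex.I * s.im‖ := by
    refine le_trans (le_of_eq ?_) (Complex.abs_im_le_norm _); simp
  have l3 : |s.im| ≤ ‖(x:ℂ) + 2 * Complex.I * s.im‖ := by
    refine le_trans ?_ (Complex.abs_im_le_norm _); simp [abs_mul]; linarith
  have lt : wt s / 3 ≤ |s.im| := by unfold wt; linarith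
  have hw := wt_pos s
  have m1 : x ^ 3 * (wt s / 3) ^ 4 * (wt s / 3) ≤ A ^ 3 * ‖riemannZeta₁ s‖ ^ 4 * (C * (4 * wt s ^ (1 + 2 * ε))) := by
    calc x ^ 3 * (wt s / 3) ^ 4 * (wt s / 3) ≤ x ^ 3 * ‖(x:ℂ) + Complex.I * s.im‖ ^ 4 * ‖(x:ℂ) + 2 * Complex.I * s.im‖ := by
          gcongr
          · exact lt.trans l2
          · exact lt.trans l3
      _ ≤ _ := h
      _ ≤ _ := by gcongr
  have e5 : wt s ^ (4 - 2 * ε) * wt s ^ (1 + 2 * ε) = wt s ^ 5 := by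
    rw [← Real.rpow_add hw, ← Real.rpow_natCast]; norm_num
  have hp : 0 < wt s ^ (1 + 2 * ε) := by positivity
  rw [← mul_le_mul_iff_left₀ (show 0 < 243 * A ^ 3 * (4 * C) * wt s ^ (1 + 2 * ε) by positivity)]
  calc c4 * x ^ 3 * wt s ^ (4 - 2 * ε) * (243 * A ^ 3 * (4 * C) * wt s ^ (1 + 2 * ε))
      = (c4 * (243 * A ^ 3 * (4 * C))) * x ^ 3 * (wt s ^ (4 - 2 * ε) * wt s ^ (1 + 2 * ε)) := by ring
    _ = x ^ 3 * wt s ^ 5 := by rw [e5, hc4]; field_simp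
    _ = 243 * (x ^ 3 * (wt s / 3) ^ 4 * (wt s / 3)) := by ring
    _ ≤ 243 * (A ^ 3 * ‖riemannZeta₁ s‖ ^ 4 * (C * (4 * wt s ^ (1 + 2 * ε)))) := by gcongr
    _ = _ := by ring

lemma Z_lower_big (ε : ℝ) (h0 : 0 < ε) (h1 : ε ≤ 1/4) : ∃ c : ℝ, 0 < c ∧ ∀ s : ℂ, 1 ≤ s.re → s.re ≤ 2 → 1 ≤ |s.im| →
    c * wt s ^ (1 - 10 * ε) ≤ ‖riemannZeta₁ s‖ := by
  obtain ⟨c, hc, hl⟩ := Z_lower4 ε h0 h1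
  obtain ⟨D, hD, hlip⟩ := Z_lip ε h0 h1
  set κ : ℝ := min (ε / 2) (c / (2 * D)) with hκ
  have hκ0 : 0 < κ := by positivity
  have hκ1 : κ ≤ ε / 2 := min_le_left _ _
  have hκ2 : D * κ ≤ c / 2 := by
    have : κ ≤ c / (2 * D) := min_le_right _ _
    rw [le_div_iff₀ (by positivity)] at this
    linarith
  have hκ3 : κ ≤ 1 := by linarith
  refine ⟨c * κ ^ 3 / 2, by positivity, fun s hs hs2 ht => ?_⟩
  set w := wt s with hw
  have hw0 : 0 < w := wt_pos s
  have hw1 : 1 ≤ w := one_le_wt s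
  set y : ℝ := κ * w ^ (-(3 * ε)) with hy
  have hy0 : 0 < y := by positivity
  have hyk : y ≤ κ := by
    have : w ^ (-(3 * ε)) ≤ 1 := Real.rpow_le_one_of_one_le_of_nonpos hw1 (by linarith)
    calc y ≤ κ * 1 := by rw [hy]; gcongr
      _ = κ := mul_one _
  have hy4 : y ^ 4 ≤ ε / 2 := by
    have : y ^ 4 ≤ y ^ 1 := pow_le_pow_of_le_one hy0.le (by linarith) (by norm_num)
    rw [pow_one] at this; linarith
  -- main bound for points with re ≥ 1 + y^4
  have main : ∀ z : ℂ, 1 + y ^ 4 ≤ z.re → z.re ≤ 2 → z.im = s.im → c * y ^ 3 * w ^ (1 - ε/2) ≤ ‖riemannZeta₁ z‖ := by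
    intro z hz hz2 hzi
    have hwz : wt z = w := by rw [hw, wt, wt, hzi]
    have h4 := hl z (by linarith [pow_pos hy0 4]) hz2 (by rw [hzi]; exact ht)
    rw [hwz] at h4
    rw [← pow_le_pow_iff_left₀ (by positivity) (norm_nonneg _) (show (4:ℕ) ≠ 0 by norm_num)]
    refine le_trans ?_ h4
    have e1 : (w ^ (1 - ε/2)) ^ 4 = w ^ (4 - 2 * ε) := by
      rw [← Real.rpow_natCast, ← Real.rpow_mul hw0.le]; congr 1; push_cast; ring
    rw [mul_pow, mul_pow, e1, ← pow_mul]
    have e2 : y ^ (3 * 4) = (y ^ 4) ^ 3 := by rw [← pow_mul]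
    rw [e2]
    gcongr
    linarith
  have hyw : y ^ 3 * w ^ (1 - ε/2) = κ ^ 3 * w ^ (1 - 9 * ε - ε/2) := by
    rw [hy, mul_pow, ← Real.rpow_natCast (w ^ (-(3*ε))), ← Real.rpow_mul hw0.le, mul_assoc, ← Real.rpow_add hw0]
    congr 2; push_cast; ring
  have hfin : c * κ ^ 3 / 2 * w ^ (1 - 10 * ε) ≤ c / 2 * (y ^ 3 * w ^ (1 - ε/2)) := by
    rw [hyw]
    have : w ^ (1 - 10 * ε) ≤ w ^ (1 - 9 * ε - ε/2) := Real.rpow_le_rpow_of_exponent_le hw1 (by linarith)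
    calc c * κ ^ 3 / 2 * w ^ (1 - 10 * ε) ≤ c * κ ^ 3 / 2 * w ^ (1 - 9 * ε - ε/2) := by gcongr
      _ = _ := by ring
  refine hfin.trans ?_
  by_cases hcase : 1 + y ^ 4 ≤ s.re
  · refine le_trans ?_ (main s hcase hs2 rfl)
    have : 0 < c * y ^ 3 * w ^ (1 - ε/2) := by positivity
    linarith
  · push Not at hcase
    set z : ℂ := ⟨1 + y ^ 4, s.im⟩ with hz
    have hm := main z (by simp [hz]) (by simp [hz]; linarith) (by simp [hz])
    have hzs : ‖z - s‖ ≤ y ^ 4 := by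
      have : z - s = ((1 + y ^ 4 - s.re : ℝ) : ℂ) := by apply Complex.ext <;> simp only [hz, Complex.sub_re, Complex.sub_im, Complex.ofReal_re, Complex.ofReal_im, sub_self]
      rw [this, Complex.norm_real, Real.norm_eq_abs, abs_le]
      constructor <;> linarith
    have h2 := (hlip s z hs hs2 (hzs.trans hy4)).1
    have h3 : ‖riemannZeta₁ z‖ ≤ ‖riemannZeta₁ s‖ + ‖riemannZeta₁ z - riemannZeta₁ s‖ := by
      have := norm_add_le (riemannZeta₁ s) (riemannZeta₁ z - riemannZeta₁ s)
      simpa using this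
    have h4 : ‖riemannZeta₁ z - riemannZeta₁ s‖ ≤ c / 2 * (y ^ 3 * w ^ (1 - ε/2)) := by
      calc _ ≤ D * w ^ (1 + 2 * ε) * ‖z - s‖ := h2
        _ ≤ D * w ^ (1 + 2 * ε) * y ^ 4 := by gcongr
        _ = D * κ * (y ^ 3 * (w ^ (1 + 2 * ε) * w ^ (-(3 * ε)))) := by rw [pow_succ y 3]; nth_rewrite 2 [hy]; ring
        _ = D * κ * (y ^ 3 * w ^ (1 - ε)) := by rw [← Real.rpow_add hw0]; congr 3; ring
        _ ≤ c / 2 * (y ^ 3 * w ^ (1 - ε/2)) := by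
            gcongr
            linarith
    linarith

lemma Z_lower (ε : ℝ) (h0 : 0 < ε) (h1 : ε ≤ 1/4) : ∃ c : ℝ, 0 < c ∧ ∀ s : ℂ, 1 ≤ s.re → s.re ≤ 2 →
    c * wt s ^ (1 - 10 * ε) ≤ ‖riemannZeta₁ s‖ := by
  obtain ⟨c, hc, hl⟩ := Z_lower_big ε h0 h1
  have hK : IsCompact (Set.Icc (1:ℝ) 2 ×ℂ Set.Icc (-1:ℝ) 1) := isCompact_Icc.reProdIm isCompact_Icc
  obtain ⟨z0, hz0, hmin⟩ := hK.exists_isMinOn ⟨1, by simp [Complex.mem_reProdIm]⟩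
    (f := fun z => ‖riemannZeta₁ z‖) (differentiable_riemannZeta₁.continuous.norm.continuousOn)
  have hp : 0 < ‖riemannZeta₁ z0‖ := norm_pos_iff.mpr (Z_ne_zero hz0.1.1)
  refine ⟨min c (‖riemannZeta₁ z0‖ / 3), by positivity, fun s hs hs2 => ?_⟩
  have hwp := wt_pos s
  by_cases ht : 1 ≤ |s.im|
  · refine le_trans ?_ (hl s hs hs2 ht)
    gcongr
    exact min_le_left _ _
  · push Not at ht
    have hmem : s ∈ Set.Icc (1:ℝ) 2 ×ℂ Set.Icc (-1:ℝ) 1 := by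
      rw [Complex.mem_reProdIm]
      rw [abs_lt] at ht
      exact ⟨⟨hs, hs2⟩, ⟨ht.1.le, ht.2.le⟩⟩
    have h3 : ‖riemannZeta₁ z0‖ ≤ ‖riemannZeta₁ s‖ := hmin hmem
    have h4 : wt s ^ (1 - 10 * ε) ≤ 3 := by
      calc wt s ^ (1 - 10 * ε) ≤ wt s ^ (1:ℝ) := Real.rpow_le_rpow_of_exponent_le (one_le_wt s) (by linarith)
        _ = wt s := Real.rpow_one _
        _ ≤ 3 := by unfold wt; linarith
    calc min c (‖riemannZeta₁ z0‖ / 3) * wt s ^ (1 - 10 * ε) ≤ (‖riemannZeta₁ z0‖ / 3) * 3 := by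
          gcongr
          exact min_le_right _ _
      _ = ‖riemannZeta₁ z0‖ := by ring
      _ ≤ _ := h3

/-- The Mellin transform of `ψ(x) - x`. -/
noncomputable def G (s : ℂ) : ℂ := (-(deriv riemannZeta₁ s / riemannZeta₁ s) - 1) / s

lemma G_differentiableAt {s : ℂ} (hs : s ≠ 0) (hZ : riemannZeta₁ s ≠ 0) : DifferentiableAt ℂ G s := by
  have h1 : DifferentiableAt ℂ (deriv riemannZeta₁) s :=
    (differentiable_riemannZeta₁.analyticAt s).deriv.differentiableAt
  have h2 := differentiable_riemannZeta₁ s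
  unfold G
  fun_prop (disch := assumption)

lemma G_iteratedDeriv_bound (k : ℕ) : ∃ C : ℝ, 0 < C ∧ ∀ j ≤ k, ∀ s : ℂ, 1 ≤ s.re → s.re ≤ 2 →
    ‖iteratedDeriv j G s‖ ≤ C := by
  set ε : ℝ := 1 / (12 * (k + 1)) with hε
  have hk0 : (0:ℝ) ≤ k := Nat.cast_nonneg k
  have h0 : 0 < ε := by positivity
  have h1 : ε ≤ 1/4 := by
    rw [hε]
    apply one_div_le_one_div_of_le (by norm_num); linarith
  have hεk : 12 * ε * (k + 1) = 1 := by rw [hε]; field_simp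
  obtain ⟨c, hc, hl⟩ := Z_lower ε h0 h1
  obtain ⟨D, hD, hlip⟩ := Z_lip ε h0 h1
  set κ : ℝ := min (ε / 2) (c / (2 * D)) with hκ
  have hκ0 : 0 < κ := by positivity
  have hκ1 : κ ≤ ε / 2 := min_le_left _ _
  have hκ2 : D * κ ≤ c / 2 := by
    have : κ ≤ c / (2 * D) := min_le_right _ _
    rw [le_div_iff₀ (by positivity)] at this
    linarith
  have hκ3 : κ ≤ 1 := by linarith
  set B : ℝ := 8 * (2 * D / c + 1) with hB
  have hB0 : 0 < B := by positivity
  refine ⟨(k.factorial : ℝ) * B / κ ^ k, by positivity, fun j hj s hs hs2 => ?_⟩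
  set w := wt s with hw
  have hw0 : 0 < w := wt_pos s
  have hw1 : 1 ≤ w := one_le_wt s
  set r : ℝ := κ * w ^ (-(12 * ε)) with hr
  have hr0 : 0 < r := by positivity
  have hrk : r ≤ κ := by
    have : w ^ (-(12 * ε)) ≤ 1 := Real.rpow_le_one_of_one_le_of_nonpos hw1 (by linarith)
    calc r ≤ κ * 1 := by rw [hr]; gcongr
      _ = κ := mul_one _
  have hre : r ≤ ε / 2 := hrk.trans hκ1
  -- lower bound on the disk
  have low : ∀ z : ℂ, ‖z - s‖ ≤ r → c / 2 * w ^ (1 - 10 * ε) ≤ ‖riemannZeta₁ z‖ := by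
    intro z hz
    have a1 := (hlip s z hs hs2 (hz.trans hre)).1
    have a2 := hl s hs hs2
    have a3 : ‖riemannZeta₁ s‖ ≤ ‖riemannZeta₁ z‖ + ‖riemannZeta₁ z - riemannZeta₁ s‖ := by
      have := norm_sub_le (riemannZeta₁ z) (riemannZeta₁ z - riemannZeta₁ s)
      simpa using this
    have a4 : D * w ^ (1 + 2 * ε) * ‖z - s‖ ≤ c / 2 * w ^ (1 - 10 * ε) := by
      calc D * w ^ (1 + 2 * ε) * ‖z - s‖ ≤ D * w ^ (1 + 2 * ε) * r := by gcongr
        _ = D * κ * (w ^ (1 + 2 * ε) * w ^ (-(12 * ε))) := by rw [hr]; ring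
        _ = D * κ * w ^ (1 - 10 * ε) := by rw [← Real.rpow_add hw0]; congr 2; ring
        _ ≤ _ := by gcongr
    linarith
  have lowpos : ∀ z : ℂ, ‖z - s‖ ≤ r → riemannZeta₁ z ≠ 0 := by
    intro z hz h
    have := low z hz
    rw [h, norm_zero] at this
    have h2 : 0 < c / 2 * w ^ (1 - 10 * ε) := by positivity
    linarith
  have lowz : ∀ z : ℂ, ‖z - s‖ ≤ r → w / 8 ≤ ‖z‖ := by
    intro z hz
    have i1 : |z.im - s.im| ≤ 1/8 := by
      have := Complex.abs_im_le_norm (z - s)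
      rw [Complex.sub_im] at this
      linarith
    have i2 := abs_le.mp (abs_re_sub_le hz)
    have i3 := Complex.abs_im_le_norm z
    have i4 := Complex.abs_re_le_norm z
    have i5 := le_abs_self z.re
    have i6 := abs_sub_abs_le_abs_sub s.im z.im
    rw [abs_sub_comm] at i6
    rw [hw, wt]
    by_cases ht : 1 ≤ |s.im| <;> linarith
  have nz : ∀ z : ℂ, ‖z - s‖ ≤ r → z ≠ 0 := by
    intro z hz h
    have := lowz z hz
    rw [h, norm_zero] at this; linarith
  have bound : ∀ z : ℂ, ‖z - s‖ ≤ r → ‖G z‖ ≤ B * w ^ (12 * ε - 1) := by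
    intro z hz
    have a1 := (hlip s z hs hs2 (hz.trans hre)).2
    have a2 := low z hz
    have a3 := lowz z hz
    have h2 : 0 < c / 2 * w ^ (1 - 10 * ε) := by positivity
    unfold G
    rw [norm_div]
    have a4 : ‖deriv riemannZeta₁ z / riemannZeta₁ z‖ ≤ 2 * D / c * w ^ (12 * ε) := by
      rw [norm_div]
      calc _ ≤ (D * w ^ (1 + 2 * ε)) / (c / 2 * w ^ (1 - 10 * ε)) := by gcongr
        _ = 2 * D / c * (w ^ (1 + 2 * ε) / w ^ (1 - 10 * ε)) := by field_simp
        _ = _ := by rw [← Real.rpow_sub hw0]; congr 2; ring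
    have a5 : ‖-(deriv riemannZeta₁ z / riemannZeta₁ z) - 1‖ ≤ (2 * D / c + 1) * w ^ (12 * ε) := by
      refine (norm_sub_le _ _).trans ?_
      rw [norm_neg, norm_one]
      have : 1 ≤ w ^ (12 * ε) := Real.one_le_rpow hw1 (by positivity)
      linarith
    calc _ ≤ ((2 * D / c + 1) * w ^ (12 * ε)) / (w / 8) := by gcongr
      _ = B * (w ^ (12 * ε) / w) := by rw [hB]; field_simp
      _ = _ := by rw [Real.rpow_sub_one hw0.ne']
  have hdiff : DiffContOnCl ℂ G (Metric.ball s r) := by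
    apply DifferentiableOn.diffContOnCl_ball (U := Metric.closedBall s r) _ subset_rfl
    intro z hz
    rw [mem_closedBall_iff_norm] at hz
    exact (G_differentiableAt (nz z hz) (lowpos z hz)).differentiableWithinAt
  have fin := Complex.norm_iteratedDeriv_le_of_forall_mem_sphere_norm_le j hr0 hdiff
    (C := B * w ^ (12 * ε - 1)) (fun z hz => by
      rw [mem_sphere_iff_norm] at hz
      exact bound z hz.le)
  refine fin.trans ?_
  have e1 : r ^ j = κ ^ j * w ^ (-(12 * ε * j)) := by
    rw [hr, mul_pow, ← Real.rpow_natCast (w ^ (-(12*ε))), ← Real.rpow_mul hw0.le]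
    congr 2; ring
  have e2 : w ^ (12 * ε - 1) / w ^ (-(12 * ε * j)) ≤ 1 := by
    rw [← Real.rpow_sub hw0]
    apply Real.rpow_le_one_of_one_le_of_nonpos hw1
    have : (j:ℝ) ≤ k := by exact_mod_cast hj
    nlinarith
  have e3 : κ ^ k ≤ κ ^ j := pow_le_pow_of_le_one hκ0.le hκ3 hj
  have e4 : (j.factorial : ℝ) ≤ k.factorial := by exact_mod_cast Nat.factorial_le hj
  calc (j.factorial : ℝ) * (B * w ^ (12 * ε - 1)) / r ^ j
      = j.factorial * B / κ ^ j * (w ^ (12 * ε - 1) / w ^ (-(12 * ε * j))) := by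
        rw [e1]; field_simp
    _ ≤ j.factorial * B / κ ^ j * 1 := by gcongr
    _ ≤ _ := by rw [mul_one]; gcongr

end PNT

end PartPA3

section PartPA4

open Complex Set MeasureTheory Filter Topology
open scoped FourierTransform

namespace PNT


lemma psi_sub_abs_le {t : ℝ} (ht : 0 ≤ t) : |Chebyshev.psi t - t| ≤ 7 * t := by
  have h1 := Chebyshev.psi_le_const_mul_self ht
  have h2 := Chebyshev.psi_nonneg t
  have h3 : Real.log 4 ≤ 4 - 1 := Real.log_le_sub_one_of_pos (by norm_num)
  rw [abs_le]
  constructor <;> nlinarith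

lemma psi_meas : Measurable Chebyshev.psi := Chebyshev.psi_mono.measurable

lemma integrableOn_psi_cpow {s : ℂ} (hs : 1 < s.re) :
    IntegrableOn (fun t : ℝ => ((Chebyshev.psi t - t : ℝ) : ℂ) * (t : ℂ) ^ (-(s + 1))) (Ioi 1) := by
  have h : IntegrableOn (fun t : ℝ => 7 * t ^ (-s.re)) (Ioi 1) :=
    (integrableOn_Ioi_rpow_of_lt (by linarith) one_pos).const_mul 7
  refine Integrable.mono' h ?_ ?_
  · refine AEStronglyMeasurable.mul ?_ ?_
    · exact (Complex.measurable_ofReal.comp (psi_meas.sub measurable_id)).aestronglyMeasurable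
    · refine ContinuousOn.aestronglyMeasurable (fun t ht ↦ ?_) measurableSet_Ioi
      exact (Complex.continuousAt_ofReal_cpow_const _ _ (Or.inr (zero_lt_one.trans ht).ne')).continuousWithinAt
  · filter_upwards [ae_restrict_mem measurableSet_Ioi] with t ht
    have ht0 : 0 < t := zero_lt_one.trans ht
    rw [norm_mul, Complex.norm_real, Complex.norm_cpow_eq_rpow_re_of_pos ht0]
    calc |Chebyshev.psi t - t| * t ^ (-(s+1)).re ≤ 7 * t * t ^ (-(s+1)).re := by
          gcongr; exact psi_sub_abs_le ht0.le
      _ = 7 * t ^ (-s.re) := by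
          rw [mul_assoc, ← Real.rpow_one_add' ht0.le]
          · simp
          · simp; linarith

lemma mellin_G {s : ℂ} (hs : 1 < s.re) :
    ∫ t in Ioi (1:ℝ), ((Chebyshev.psi t - t : ℝ) : ℂ) * (t : ℂ) ^ (-(s + 1)) = G s := by
  have hs1 : s ≠ 1 := by rintro rfl; simp at hs
  have hs0 : s ≠ 0 := by rintro rfl; simp at hs; linarith
  have hL := LSeries_eq_mul_integral_of_nonneg (fun n => ArithmeticFunction.vonMangoldt n) zero_le_one hs
    (by
      refine Asymptotics.IsBigO.of_bound 7 (Eventually.of_forall fun n => ?_)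
      have h1 := Chebyshev.psi_le_const_mul_self (Nat.cast_nonneg n : (0:ℝ) ≤ n)
      have h3 : Real.log 4 ≤ 4 - 1 := Real.log_le_sub_one_of_pos (by norm_num)
      have h4 : ∑ k ∈ Finset.Icc 1 n, ArithmeticFunction.vonMangoldt k = Chebyshev.psi n := by
        rw [Chebyshev.psi, Nat.floor_natCast]; rfl
      rw [h4, Real.norm_of_nonneg (Chebyshev.psi_nonneg _), Real.rpow_one, Real.norm_of_nonneg (Nat.cast_nonneg n)]
      have : (0:ℝ) ≤ n := Nat.cast_nonneg n
      nlinarith) (fun n => ArithmeticFunction.vonMangoldt_nonneg)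
  have hv := ArithmeticFunction.LSeries_vonMangoldt_eq_deriv_riemannZeta_div hs
  rw [hv] at hL
  have hI2 : ∫ t in Ioi (1:ℝ), (t : ℂ) ^ (-s) = 1 / (s - 1) := by
    rw [integral_Ioi_cpow_of_lt (by simpa using hs) one_pos]
    have : s - 1 ≠ 0 := sub_ne_zero.2 hs1
    have h2 : -s + 1 ≠ 0 := by intro h; apply this; linear_combination -h
    simp
    field_simp
    ring
  have hi2 : IntegrableOn (fun t : ℝ => (t : ℂ) ^ (-s)) (Ioi 1) :=
    integrableOn_Ioi_cpow_of_lt (by simpa using hs) one_pos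
  have key : ∫ t in Ioi (1:ℝ), (∑ k ∈ Finset.Icc 1 ⌊t⌋₊, ((ArithmeticFunction.vonMangoldt k : ℝ) : ℂ)) * (t:ℂ) ^ (-(s + 1))
      = (∫ t in Ioi (1:ℝ), ((Chebyshev.psi t - t : ℝ) : ℂ) * (t : ℂ) ^ (-(s + 1))) + 1 / (s - 1) := by
    rw [← hI2, ← integral_add (integrableOn_psi_cpow hs) hi2]
    refine setIntegral_congr_fun measurableSet_Ioi fun t ht => ?_
    have ht0 : (0:ℝ) < t := zero_lt_one.trans ht
    have ht1 : (t:ℂ) ≠ 0 := by exact_mod_cast ht0.ne'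
    have h4 : ∑ k ∈ Finset.Icc 1 ⌊t⌋₊, ((ArithmeticFunction.vonMangoldt k : ℝ) : ℂ) = (Chebyshev.psi t : ℂ) := by
      rw [Chebyshev.psi]; push_cast; rfl
    have h5 : (t:ℂ) ^ (-s) = t * (t:ℂ) ^ (-(s+1)) := by
      rw [show -s = 1 + (-(s+1)) by ring, cpow_add _ _ ht1, cpow_one]
    simp only [h4, h5]
    push_cast
    ring
  rw [key] at hL
  have hZ := Z_ne_zero hs.le
  rw [deriv_riemannZeta_eq_neg_inv_sub_sq_mul_add hs1, riemannZeta_eq_inv_sub_mul hs1] at hL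
  have : s - 1 ≠ 0 := sub_ne_zero.2 hs1
  rw [G, eq_div_iff hs0]
  have h6 : (∫ t in Ioi (1:ℝ), ((Chebyshev.psi t - t : ℝ) : ℂ) * (t : ℂ) ^ (-(s + 1))) * s =
    s * ((∫ t in Ioi (1:ℝ), ((Chebyshev.psi t - t : ℝ) : ℂ) * (t : ℂ) ^ (-(s + 1))) + 1 / (s - 1)) - s / (s - 1) := by
    ring
  rw [h6, ← hL]
  field_simp
  ring

/-- The weighted error function. -/
noncomputable def E (σ : ℝ) (w : ℝ) : ℝ := indicator (Ioi 0) (fun w => Real.exp (-σ * w) * (Chebyshev.psi (Real.exp w) - Real.exp w)) w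

lemma exp_smul_eq (s : ℂ) (w : ℝ) : Real.exp w • (((Chebyshev.psi (Real.exp w) - Real.exp w : ℝ) : ℂ) * ((Real.exp w : ℝ) : ℂ) ^ (-(s + 1)))
    = Complex.exp (-s * w) * ((Chebyshev.psi (Real.exp w) - Real.exp w : ℝ) : ℂ) := by
  have h : ((Real.exp w : ℝ) : ℂ) ^ (-(s+1)) = Complex.exp (-s * w) * Complex.exp (-w) := by
    rw [cpow_def_of_ne_zero (by exact_mod_cast (Real.exp_pos w).ne'), ← Complex.ofReal_log (Real.exp_pos w).le, Real.log_exp, ← Complex.exp_add]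
    congr 1; ring
  rw [h, Complex.real_smul, Complex.ofReal_exp]
  have : Complex.exp w * Complex.exp (-w) = 1 := by rw [← Complex.exp_add]; simp
  linear_combination (Complex.exp (-s * w) * ((Chebyshev.psi (Real.exp w) - Real.exp w : ℝ) : ℂ)) * this

lemma E_integrable {σ : ℝ} (hσ : 1 < σ) : Integrable (fun w => (E σ w : ℂ)) := by
  have h1 := (integrableOn_comp_exp_Ioi (fun t : ℝ => ((Chebyshev.psi t - t : ℝ) : ℂ) * (t : ℂ) ^ (-((σ:ℂ) + 1))) 0).2
    (by rw [Real.exp_zero]; exact integrableOn_psi_cpow (by simpa using hσ))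
  rw [← integrable_indicator_iff measurableSet_Ioi] at h1
  refine h1.congr (Eventually.of_forall fun w => ?_)
  by_cases hw : w ∈ Ioi (0:ℝ)
  · simp only [E, indicator_of_mem hw, exp_smul_eq]
    push_cast; rfl
  · simp only [E, indicator_of_notMem hw]; simp

lemma E_fourier {σ : ℝ} (hσ : 1 < σ) (ξ : ℝ) : 𝓕 (fun w => (E σ w : ℂ)) ξ = G (σ + 2 * Real.pi * I * ξ) := by
  rw [← mellin_G (by simpa using hσ)]
  have h1 := integral_comp_exp_Ioi (fun t : ℝ => ((Chebyshev.psi t - t : ℝ) : ℂ) * (t : ℂ) ^ (-(((σ:ℂ) + 2 * Real.pi * I * ξ) + 1))) 0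
  rw [Real.exp_zero] at h1
  rw [← h1, Real.fourier_eq', ← integral_indicator measurableSet_Ioi]
  refine integral_congr_ae (Eventually.of_forall fun w => ?_)
  by_cases hw : w ∈ Ioi (0:ℝ)
  · simp only [E, indicator_of_mem hw, exp_smul_eq]
    push_cast
    rw [smul_eq_mul, ← mul_assoc, ← Complex.exp_add]
    congr 2
    simp
    ring
  · simp only [E, indicator_of_notMem hw]; simp

end PNT

end PartPA4

section PartPA5

open Complex Set MeasureTheory Filter Topology
open scoped FourierTransform SchwartzMap ContDiff

namespace PNT

/-- real bump function -/
noncomputable def bmp : ContDiffBump (0:ℝ) := ⟨1/2, 1, by norm_num, by norm_num⟩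
noncomputable def phi (x : ℝ) : ℝ := bmp.normed volume x

lemma phi_nonneg (x : ℝ) : 0 ≤ phi x := bmp.nonneg_normed x
lemma phi_int : ∫ x, phi x = 1 := bmp.integral_normed
lemma phi_integrable : Integrable phi := bmp.integrable_normed
lemma phi_cont : Continuous phi := bmp.continuous_normed
lemma phi_zero {x : ℝ} (hx : 1 ≤ |x|) : phi x = 0 := by
  have : x ∉ Function.support phi := by
    change x ∉ Function.support (bmp.normed volume)
    rw [bmp.support_normed_eq]
    simp [bmp]
    exact hx
  simpa using this

lemma phi_exists : ∃ g : 𝓢(ℝ, ℂ), ∀ x, 𝓕 (fun ξ => g ξ) x = (phi x : ℂ) := by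
  have h1 : HasCompactSupport (fun x => (phi x : ℂ)) := by
    have : HasCompactSupport phi := bmp.hasCompactSupport_normed
    exact this.comp_left (g := fun r : ℝ => (r:ℂ)) (by simp)
  have h2 : ContDiff ℝ ∞ (fun x => (phi x : ℂ)) :=
    Complex.ofRealCLM.contDiff.comp (bmp.contDiff_normed (n := ⊤))
  refine ⟨𝓕⁻ (h1.toSchwartzMap h2), fun x => ?_⟩
  have h3 : 𝓕 (𝓕⁻ (h1.toSchwartzMap h2)) x = (h1.toSchwartzMap h2) x := by simp
  rw [SchwartzMap.fourier_coe] at h3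
  exact h3

lemma G_analyticAt {s : ℂ} (hs : 1 ≤ s.re) : AnalyticAt ℂ G s := by
  rw [Complex.analyticAt_iff_eventually_differentiableAt]
  have ho : IsOpen {s : ℂ | s ≠ 0 ∧ riemannZeta₁ s ≠ 0} := by
    refine IsOpen.inter isOpen_ne ?_
    have hc : Continuous riemannZeta₁ := differentiable_riemannZeta₁.continuous
    exact isOpen_ne_fun hc continuous_const
  filter_upwards [ho.mem_nhds (x := s) ⟨by
    rintro rfl; simp at hs; linarith, Z_ne_zero hs⟩] with s hs
  exact G_differentiableAt hs.1 hs.2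

lemma G_line_iter {σ : ℝ} (hσ : 1 ≤ σ) (j : ℕ) :
    iteratedDeriv j (fun ξ : ℝ => G (σ + 2 * Real.pi * I * ξ)) =
      fun ξ : ℝ => (2 * Real.pi * I) ^ j * iteratedDeriv j G (σ + 2 * Real.pi * I * ξ) := by
  induction j with
  | zero => simp
  | succ j ih =>
    rw [iteratedDeriv_succ, ih]
    funext ξ
    have han : AnalyticAt ℂ G (σ + 2 * Real.pi * I * ξ) := G_analyticAt (by simpa using hσ)
    have hd : DifferentiableAt ℂ (iteratedDeriv j G) (σ + 2 * Real.pi * I * ξ) := by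
      rw [iteratedDeriv_eq_iterate]
      exact (han.iterated_deriv j).differentiableAt
    have h1 : HasDerivAt (iteratedDeriv j G) (iteratedDeriv (j+1) G (σ + 2 * Real.pi * I * ξ)) (σ + 2 * Real.pi * I * ξ) := by
      rw [iteratedDeriv_succ]; exact hd.hasDerivAt
    have h2 : HasDerivAt (fun z : ℂ => σ + 2 * Real.pi * I * z) (2 * Real.pi * I) (ξ:ℂ) := by
      simpa using ((hasDerivAt_id (ξ:ℂ)).const_mul (2 * Real.pi * I)).const_add (σ:ℂ)
    have h3 := ((h1.comp (ξ:ℂ) h2).comp_ofReal).const_mul ((2 * Real.pi * I) ^ j)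
    have h4 := h3.deriv
    simp only [Function.comp_def] at h4
    rw [h4]
    ring

lemma G_line_contDiff {σ : ℝ} (hσ : 1 ≤ σ) : ContDiff ℝ ∞ (fun ξ : ℝ => G (σ + 2 * Real.pi * I * ξ)) := by
  rw [contDiff_iff_contDiffAt]
  intro ξ
  have han : AnalyticAt ℂ G (σ + 2 * Real.pi * I * ξ) := G_analyticAt (by simpa using hσ)
  have h1 : ContDiffAt ℝ ∞ G (σ + 2 * Real.pi * I * ξ) := (han.contDiffAt (n := ∞)).restrict_scalars ℝ
  have : ContDiff ℝ ∞ (fun ξ : ℝ => (σ + 2 * Real.pi * I * ξ : ℂ)) :=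
    contDiff_const.add (contDiff_const.mul Complex.ofRealCLM.contDiff)
  exact ContDiffAt.comp (f := fun ξ : ℝ => (σ + 2 * Real.pi * I * ξ : ℂ)) ξ h1 this.contDiffAt

/-- sum of the norms of the derivatives -/
noncomputable def Bsum (g : 𝓢(ℝ, ℂ)) (k : ℕ) (y : ℝ) : ℝ := ∑ i ∈ Finset.range (k+1), ‖iteratedDeriv i g y‖

lemma Bsum_nonneg (g : 𝓢(ℝ, ℂ)) (k : ℕ) (y : ℝ) : 0 ≤ Bsum g k y := Finset.sum_nonneg fun _ _ => norm_nonneg _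

lemma Bsum_integrable (g : 𝓢(ℝ, ℂ)) (k : ℕ) : Integrable (Bsum g k) := by
  refine integrable_finsetSum _ fun i _ => ?_
  have := g.integrable_pow_mul_iteratedFDeriv volume 0 i
  simpa [norm_iteratedFDeriv_eq_norm_iteratedDeriv] using this

/-- H -/
noncomputable def H (g : 𝓢(ℝ, ℂ)) (σ δ ξ : ℝ) : ℂ := G (σ + 2 * Real.pi * I * ξ) * (δ * g (δ * ξ))

lemma g_scale_contDiff (g : 𝓢(ℝ, ℂ)) (δ : ℝ) : ContDiff ℝ ∞ (fun ξ : ℝ => (δ : ℂ) * g (δ * ξ)) :=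
  contDiff_const.mul ((g.smooth ⊤).comp (contDiff_const.mul contDiff_id))

lemma H_contDiff (g : 𝓢(ℝ, ℂ)) {σ : ℝ} (hσ : 1 ≤ σ) (δ : ℝ) : ContDiff ℝ ∞ (H g σ δ) :=
  (G_line_contDiff hσ).mul (g_scale_contDiff g δ)

lemma H_bound (g : 𝓢(ℝ, ℂ)) (k : ℕ) : ∃ C : ℝ, 0 < C ∧ ∀ σ : ℝ, 1 ≤ σ → σ ≤ 2 → ∀ δ : ℝ, 0 < δ → δ ≤ 1 → ∀ j ≤ k, ∀ ξ : ℝ,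
    ‖iteratedDeriv j (H g σ δ) ξ‖ ≤ C * (δ * Bsum g k (δ * ξ)) := by
  obtain ⟨C, hC, hG⟩ := G_iteratedDeriv_bound k
  refine ⟨2 ^ k * ((2 * Real.pi) ^ k * C), by positivity, fun σ hσ hσ2 δ hδ hδ1 j hj ξ => ?_⟩
  have hpi : 1 ≤ 2 * Real.pi := by have := Real.pi_gt_three; linarith
  rw [← norm_iteratedFDeriv_eq_norm_iteratedDeriv]
  refine (norm_iteratedFDeriv_mul_le (N := ∞) (G_line_contDiff hσ) (g_scale_contDiff g δ) ξ (n := j) (by exact_mod_cast le_top)).trans ?_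
  have hterm : ∀ i ∈ Finset.range (j+1), (j.choose i : ℝ) * ‖iteratedFDeriv ℝ i (fun ξ : ℝ => G (σ + 2 * Real.pi * I * ξ)) ξ‖ *
      ‖iteratedFDeriv ℝ (j - i) (fun ξ : ℝ => (δ : ℂ) * g (δ * ξ)) ξ‖ ≤
      (j.choose i : ℝ) * (((2 * Real.pi) ^ k * C) * (δ * Bsum g k (δ * ξ))) := by
    intro i hi
    rw [Finset.mem_range] at hi
    rw [mul_assoc]
    have hB := Bsum_nonneg g k (δ * ξ)
    gcongr
    · rw [norm_iteratedFDeriv_eq_norm_iteratedDeriv, G_line_iter hσ, norm_mul, norm_pow]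
      have : ‖(2 * Real.pi * I : ℂ)‖ = 2 * Real.pi := by simp [abs_of_pos Real.pi_pos]
      rw [this]
      gcongr
      · omega
      · exact hG i (by omega) _ (by simpa using hσ) (by simpa using hσ2)
    · rw [norm_iteratedFDeriv_eq_norm_iteratedDeriv, iteratedDeriv_const_mul_field,
        congrFun (iteratedDeriv_comp_const_smul (n := j - i) (f := g) (g.smooth ((j - i : ℕ) : ℕ∞)) δ) ξ, norm_mul, norm_smul,
        Complex.norm_real, Real.norm_of_nonneg hδ.le, norm_pow, Real.norm_of_nonneg hδ.le]
      gcongr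
      have h1 : ‖iteratedDeriv (j - i) g (δ * ξ)‖ ≤ Bsum g k (δ * ξ) :=
        Finset.single_le_sum (f := fun i => ‖iteratedDeriv i g (δ * ξ)‖) (fun _ _ => norm_nonneg _) (Finset.mem_range.2 (by omega))
      calc _ ≤ 1 * ‖iteratedDeriv (j - i) g (δ * ξ)‖ := by
            gcongr
            exact pow_le_one₀ hδ.le hδ1
        _ ≤ _ := by rw [one_mul]; exact h1
  refine (Finset.sum_le_sum hterm).trans ?_
  rw [← Finset.sum_mul, ← Nat.cast_sum, Nat.sum_range_choose]
  have hB := Bsum_nonneg g k (δ * ξ)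
  push_cast
  rw [mul_assoc (2 ^ k)]
  gcongr
  norm_num

lemma fourier_flip {f g : ℝ → ℂ} (hf : Integrable f) (hg : Integrable g) :
    ∫ ξ, 𝓕 f ξ * g ξ = ∫ x, f x * 𝓕 g x := by
  have := VectorFourier.integral_fourierIntegral_smul_eq_flip (L := innerₗ ℝ)
    Real.continuous_fourierChar continuous_inner hf hg
  simpa using! this

lemma smooth_bound (k : ℕ) : ∃ C : ℝ, 0 < C ∧ ∀ σ : ℝ, 1 < σ → σ ≤ 2 → ∀ δ : ℝ, 0 < δ → δ ≤ 1 → ∀ u : ℝ, 0 < u →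
    |∫ w, E σ w * phi ((w - u) / δ)| ≤ C / u ^ k := by
  obtain ⟨g, hg⟩ := phi_exists
  obtain ⟨C, hC, hH⟩ := H_bound g k
  have hBi : 0 ≤ ∫ y, Bsum g k y := integral_nonneg fun y => Bsum_nonneg g k y
  refine ⟨C * (∫ y, Bsum g k y) + 1, by positivity, fun σ hσ hσ2 δ hδ hδ1 u hu => ?_⟩
  have hBs : Integrable (fun ξ => δ * Bsum g k (δ * ξ)) :=
    ((Bsum_integrable g k).comp_mul_left' hδ.ne').const_mul δ
  have hBsI : ∫ ξ, δ * Bsum g k (δ * ξ) = ∫ y, Bsum g k y := by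
    rw [integral_const_mul, Measure.integral_comp_mul_left, abs_of_pos (inv_pos.2 hδ), smul_eq_mul, ← mul_assoc, mul_inv_cancel₀ hδ.ne', one_mul]
  have hIterInt : ∀ j ≤ k, Integrable (iteratedDeriv j (H g σ δ)) := fun j hj => by
    refine Integrable.mono' (hBs.const_mul C) ?_ (Eventually.of_forall fun ξ => hH σ hσ.le hσ2 δ hδ hδ1 j hj ξ)
    exact ((H_contDiff g hσ.le δ).continuous_iteratedDeriv j (by exact_mod_cast le_top)).aestronglyMeasurable
  have hF := Real.fourier_iteratedDeriv (N := k) (n := k) ((H_contDiff g hσ.le δ).of_le (by exact_mod_cast le_top))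
    (fun n hn => hIterInt n (by exact_mod_cast hn)) le_rfl
  have hF1 : ‖(2 * Real.pi * I * ((-u : ℝ) : ℂ)) ^ k • 𝓕 (H g σ δ) (-u)‖ ≤ C * ∫ y, Bsum g k y := by
    have := congrFun hF (-u)
    rw [← this, ← hBsI, ← integral_const_mul]
    refine (VectorFourier.norm_fourierIntegral_le_integral_norm _ _ _ _ _).trans ?_
    refine integral_mono (hIterInt k le_rfl).norm (hBs.const_mul C) fun ξ => hH σ hσ.le hσ2 δ hδ hδ1 k le_rfl ξ
  have hfl : ((∫ w, E σ w * phi ((w - u) / δ) : ℝ) : ℂ) = 𝓕 (H g σ δ) (-u) := by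
    set h : ℝ → ℂ := fun ξ => Complex.exp (2 * Real.pi * I * ξ * u) * (δ * g (δ * ξ)) with hh
    have hhi : Integrable h := by
      have h0 : Integrable (fun ξ => (δ : ℂ) * g (δ * ξ)) := (g.integrable.comp_mul_left' hδ.ne').const_mul _
      refine (h0.bdd_mul (c := 1) ?_ ?_)
      · exact (by fun_prop : Continuous fun ξ : ℝ => Complex.exp (2 * Real.pi * I * ξ * u)).aestronglyMeasurable
      · refine Eventually.of_forall fun ξ => ?_
        rw [show (2 * Real.pi * I * ξ * u : ℂ) = ((2 * Real.pi * ξ * u : ℝ) : ℂ) * I by push_cast; ring, Complex.norm_exp_ofReal_mul_I]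
    have hFh : ∀ w, 𝓕 h w = phi ((w - u) / δ) := fun w => by
      rw [← hg, Real.fourier_eq', Real.fourier_eq']
      have h1 := Measure.integral_comp_mul_left (fun v : ℝ => Complex.exp (((-2 * Real.pi * inner ℝ v ((w - u) / δ) : ℝ) : ℂ) * I) • g v) δ
      rw [abs_of_pos (inv_pos.2 hδ)] at h1
      have h2 : ∫ v, Complex.exp (((-2 * Real.pi * inner ℝ v ((w - u) / δ) : ℝ) : ℂ) * I) • g v = δ • ∫ v, Complex.exp (((-2 * Real.pi * inner ℝ (δ * v) ((w - u) / δ) : ℝ) : ℂ) * I) • g (δ * v) := by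
        rw [h1, smul_smul, mul_inv_cancel₀ hδ.ne', one_smul]
      rw [h2, ← integral_smul]
      congr 1
      funext v
      simp only [hh, smul_eq_mul, Complex.real_smul]
      rw [← mul_assoc, ← Complex.exp_add, mul_left_comm]
      congr 2
      have hδ' : (δ:ℂ) ≠ 0 := by exact_mod_cast hδ.ne'
      simp
      field_simp
      ring_nf
    rw [← integral_complex_ofReal]
    have h3 := fourier_flip (E_integrable hσ) hhi
    simp only [hFh, E_fourier hσ] at h3
    push_cast
    rw [← h3, Real.fourier_eq']
    congr 1
    funext v
    simp only [hh, H, smul_eq_mul]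
    rw [mul_left_comm]
    congr 2
    simp
    ring
  rw [← hfl, norm_smul, norm_pow, Complex.norm_real, Real.norm_eq_abs] at hF1
  have hn : ‖(2 * Real.pi * I * ((-u : ℝ) : ℂ))‖ = 2 * Real.pi * u := by
    simp [abs_of_pos Real.pi_pos, abs_of_pos hu]
  rw [hn] at hF1
  rw [le_div_iff₀ (by positivity), mul_comm]
  have h5 : u ^ k ≤ (2 * Real.pi * u) ^ k := by
    have := Real.pi_gt_three
    gcongr; nlinarith
  have := mul_le_mul_of_nonneg_right h5 (abs_nonneg (∫ w, E σ w * phi ((w - u) / δ)))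
  linarith

end PNT

end PartPA5

section PartPA6

open Set MeasureTheory Filter Topology

namespace PNT

lemma phi_bdd : ∃ K : ℝ, ∀ x, ‖phi x‖ ≤ K :=
  phi_cont.bounded_above_of_compact_support bmp.hasCompactSupport_normed

lemma phi_scale_int {δ : ℝ} (hδ : 0 < δ) (u : ℝ) : ∫ w, phi ((w - u) / δ) = δ := by
  rw [integral_sub_right_eq_self (fun w => phi (w / δ)) u, Measure.integral_comp_div, phi_int, abs_of_pos hδ]
  simp

lemma phi_scale_integrable {δ : ℝ} (hδ : 0 < δ) (u : ℝ) : Integrable (fun w => phi ((w - u) / δ)) :=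
  (phi_integrable.comp_div hδ.ne').comp_sub_right u

lemma E_phi_integrable {σ : ℝ} (hσ : 1 < σ) (δ : ℝ) (u : ℝ) : Integrable (fun w => E σ w * phi ((w - u) / δ)) := by
  obtain ⟨K, hK⟩ := phi_bdd
  have h1 : Integrable (fun w => E σ w) := by simpa using (E_integrable hσ).re
  refine h1.mul_bdd (c := K) ?_ (Eventually.of_forall fun w => hK _)
  exact (phi_cont.comp (by fun_prop : Continuous fun w : ℝ => (w - u) / δ)).aestronglyMeasurable

lemma E_eq {σ w : ℝ} (hw : 0 < w) : E σ w = Real.exp (-σ * w) * Chebyshev.psi (Real.exp w) - Real.exp ((1 - σ) * w) := by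
  rw [E, indicator_of_mem (by exact hw), mul_sub, ← Real.exp_add]
  congr 2; ring

lemma phi_supp {δ u w : ℝ} (hδ : 0 < δ) (h : phi ((w - u) / δ) ≠ 0) : u - δ < w ∧ w < u + δ := by
  have h1 : ¬ 1 ≤ |(w - u) / δ| := fun h' => h (phi_zero h')
  push Not at h1
  rw [abs_div, abs_of_pos hδ, div_lt_one hδ, abs_lt] at h1
  constructor <;> linarith

lemma tauber (k : ℕ) : ∃ C : ℝ, 0 < C ∧ ∀ δ : ℝ, 0 < δ → δ ≤ 1 → ∀ u : ℝ, δ < u →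
    Real.exp (-(u + δ)) * Chebyshev.psi (Real.exp (u - δ)) ≤ 1 + C / (u ^ k * δ) ∧
    1 - C / (u ^ k * δ) ≤ Real.exp (-(u - δ)) * Chebyshev.psi (Real.exp (u + δ)) := by
  obtain ⟨C, hC, hb⟩ := smooth_bound k
  refine ⟨C, hC, fun δ hδ hδ1 u hu => ?_⟩
  have hu0 : 0 < u := hδ.trans hu
  have hCd : C / (u ^ k * δ) * δ = C / u ^ k := by field_simp
  have hev : ∀ᶠ σ : ℝ in 𝓝[>] 1, 1 < σ ∧ σ ≤ 2 := by
    have : Ioc (1:ℝ) 2 ∈ 𝓝[>] (1:ℝ) := Ioc_mem_nhdsGT (by norm_num)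
    exact this
  constructor
  · have hlim : Tendsto (fun σ : ℝ => Real.exp (-σ * (u + δ)) * Chebyshev.psi (Real.exp (u - δ))) (𝓝[>] 1)
        (𝓝 (Real.exp (-1 * (u + δ)) * Chebyshev.psi (Real.exp (u - δ)))) := by
      refine Tendsto.mono_left ?_ nhdsWithin_le_nhds
      exact (by fun_prop : Continuous fun σ : ℝ => Real.exp (-σ * (u + δ)) * Chebyshev.psi (Real.exp (u - δ))).tendsto 1
    rw [neg_one_mul] at hlim
    refine le_of_tendsto hlim ?_
    filter_upwards [hev] with σ hσ
    set a := Real.exp (-σ * (u + δ)) * Chebyshev.psi (Real.exp (u - δ)) with ha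
    have h1 : ∫ w, a * phi ((w - u) / δ) ≤ ∫ w, (E σ w * phi ((w - u) / δ) + phi ((w - u) / δ)) := by
      refine integral_mono ((phi_scale_integrable hδ u).const_mul a) ((E_phi_integrable hσ.1 δ u).add (phi_scale_integrable hδ u)) fun w => ?_
      simp only
      by_cases h : phi ((w - u) / δ) = 0
      · simp [h]
      obtain ⟨h2, h3⟩ := phi_supp hδ h
      have hp := phi_nonneg ((w - u) / δ)
      have hw : 0 < w := by linarith
      suffices a ≤ E σ w + 1 by nlinarith
      rw [E_eq hw]
      have h4 : Real.exp ((1 - σ) * w) ≤ 1 := Real.exp_le_one_iff.2 (by nlinarith [hσ.1])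
      have h5 : a ≤ Real.exp (-σ * w) * Chebyshev.psi (Real.exp w) := by
        rw [ha]
        refine mul_le_mul ?_ (Chebyshev.psi_mono (Real.exp_le_exp.2 h2.le)) (Chebyshev.psi_nonneg _) (Real.exp_pos _).le
        exact Real.exp_le_exp.2 (by nlinarith [hσ.1])
      linarith
    rw [integral_const_mul, integral_add (E_phi_integrable hσ.1 δ u) (phi_scale_integrable hδ u), phi_scale_int hδ u] at h1
    have h2 := (abs_le.1 (hb σ hσ.1 hσ.2 δ hδ hδ1 u hu0)).2
    have h3 : a * δ ≤ (1 + C / (u ^ k * δ)) * δ := by rw [add_mul, hCd]; linarith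
    exact le_of_mul_le_mul_right h3 hδ
  · have hlim : Tendsto (fun σ : ℝ => Real.exp (-σ * (u - δ)) * Chebyshev.psi (Real.exp (u + δ)) - Real.exp ((1 - σ) * (u + δ))) (𝓝[>] 1)
        (𝓝 (Real.exp (-1 * (u - δ)) * Chebyshev.psi (Real.exp (u + δ)) - Real.exp ((1 - 1) * (u + δ)))) := by
      refine Tendsto.mono_left ?_ nhdsWithin_le_nhds
      exact (by fun_prop : Continuous fun σ : ℝ => Real.exp (-σ * (u - δ)) * Chebyshev.psi (Real.exp (u + δ)) - Real.exp ((1 - σ) * (u + δ))).tendsto 1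
    rw [neg_one_mul, sub_self, zero_mul, Real.exp_zero] at hlim
    suffices -(C / (u ^ k * δ)) ≤ Real.exp (-(u - δ)) * Chebyshev.psi (Real.exp (u + δ)) - 1 by linarith
    refine ge_of_tendsto hlim ?_
    filter_upwards [hev] with σ hσ
    set a := Real.exp (-σ * (u - δ)) * Chebyshev.psi (Real.exp (u + δ)) - Real.exp ((1 - σ) * (u + δ)) with ha
    have h1 : ∫ w, E σ w * phi ((w - u) / δ) ≤ ∫ w, a * phi ((w - u) / δ) := by
      refine integral_mono (E_phi_integrable hσ.1 δ u) ((phi_scale_integrable hδ u).const_mul a) fun w => ?_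
      simp only
      by_cases h : phi ((w - u) / δ) = 0
      · simp [h]
      obtain ⟨h2, h3⟩ := phi_supp hδ h
      have hp := phi_nonneg ((w - u) / δ)
      have hw : 0 < w := by linarith
      refine mul_le_mul_of_nonneg_right ?_ hp
      rw [E_eq hw]
      have h4 : Real.exp ((1 - σ) * (u + δ)) ≤ Real.exp ((1 - σ) * w) := Real.exp_le_exp.2 (by nlinarith [hσ.1])
      have h5 : Real.exp (-σ * w) * Chebyshev.psi (Real.exp w) ≤ Real.exp (-σ * (u - δ)) * Chebyshev.psi (Real.exp (u + δ)) := by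
        refine mul_le_mul ?_ (Chebyshev.psi_mono (Real.exp_le_exp.2 h3.le)) (Chebyshev.psi_nonneg _) (Real.exp_pos _).le
        exact Real.exp_le_exp.2 (by nlinarith [hσ.1])
      linarith
    rw [integral_const_mul, phi_scale_int hδ u] at h1
    have h2 := (abs_le.1 (hb σ hσ.1 hσ.2 δ hδ hδ1 u hu0)).1
    have h3 : -(C / (u ^ k * δ)) * δ ≤ a * δ := by rw [neg_mul, hCd]; linarith
    exact le_of_mul_le_mul_right h3 hδ

lemma psi_bound (q : ℕ) : ∃ C : ℝ, 0 < C ∧ ∀ x : ℝ, 1 < x → |Chebyshev.psi x - x| ≤ C * (x / Real.log x ^ q) := by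
  obtain ⟨C, hC, ht⟩ := tauber (2 * q)
  set K := Real.exp 2 with hK
  have hK0 : 0 < K := Real.exp_pos 2
  set D := 2 ^ (2 * q) * C with hD
  have hD0 : 0 < D := by positivity
  refine ⟨7 * 3 ^ q + (2 * K + C + 2 * K * C) + (2 + D), by positivity, fun x hx => ?_⟩
  have hx0 : 0 < x := by linarith
  set v := Real.log x with hv
  have hv0 : 0 < v := Real.log_pos hx
  have hxv : Real.exp v = x := Real.exp_log hx0
  by_cases hv2 : v < 3
  · calc |Chebyshev.psi x - x| ≤ 7 * x := psi_sub_abs_le hx0.le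
      _ = 7 * v ^ q * (x / v ^ q) := by field_simp
      _ ≤ (7 * 3 ^ q + (2 * K + C + 2 * K * C) + (2 + D)) * (x / v ^ q) := by
        gcongr
        have : v ^ q ≤ 3 ^ q := by gcongr
        have : 0 < K * C := by positivity
        linarith
  push Not at hv2
  set δ := (v ^ q)⁻¹ with hδ
  have hδ0 : 0 < δ := by positivity
  have hδ1 : δ ≤ 1 := inv_le_one_of_one_le₀ (one_le_pow₀ (by linarith))
  have hdiv : x / v ^ q = x * δ := by rw [hδ]; rfl
  rw [hdiv]
  have hps := Chebyshev.psi_nonneg x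
  have hKC : 0 < K * C := by positivity
  rw [abs_le]
  have hqd : v ^ (2 * q) * δ = δ⁻¹ := by
    rw [hδ, inv_inv, two_mul, pow_add]; field_simp
  constructor
  · have h1 := (ht δ hδ0 hδ1 (v - δ) (by linarith)).2
    rw [sub_add_cancel, hxv] at h1
    have h2 : C / ((v - δ) ^ (2 * q) * δ) ≤ D * δ := by
      have h3 : (v / 2) ^ (2 * q) ≤ (v - δ) ^ (2 * q) := by gcongr; linarith
      calc C / ((v - δ) ^ (2 * q) * δ) ≤ C / ((v / 2) ^ (2 * q) * δ) := by gcongr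
        _ = D / (v ^ (2 * q) * δ) := by rw [hD, div_pow]; field_simp
        _ = D * δ := by rw [hqd, div_inv_eq_mul]
    have h4 : Real.exp (-(v - δ - δ)) = Real.exp (2 * δ) / x := by
      rw [← hxv, ← Real.exp_sub]; congr 1; ring
    rw [h4] at h1
    have h5 : 1 - D * δ ≤ Real.exp (2 * δ) / x * Chebyshev.psi x := by linarith
    have h6 : 1 - 2 * δ ≤ Real.exp (-(2 * δ)) := by
      have := Real.add_one_le_exp (-(2 * δ)); linarith
    have h7 : Real.exp (-(2 * δ)) ≤ 1 := Real.exp_le_one_iff.2 (by linarith)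
    have h8 : Real.exp (-(2 * δ)) * (1 - D * δ) * x ≤ Chebyshev.psi x := by
      calc _ ≤ Real.exp (-(2 * δ)) * (Real.exp (2 * δ) / x * Chebyshev.psi x) * x := by gcongr
        _ = Chebyshev.psi x := by rw [Real.exp_neg]; field_simp
    have h9 : 1 - 2 * δ - D * δ ≤ Real.exp (-(2 * δ)) * (1 - D * δ) := by
      have : Real.exp (-(2 * δ)) * (D * δ) ≤ 1 * (D * δ) := by gcongr
      linarith
    have h10 := mul_le_mul_of_nonneg_right h9 hx0.le
    have h11 : 0 ≤ (7 * 3 ^ q + (2 * K + C + 2 * K * C)) * (x * δ) := by positivity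
    linarith
  · have h1 := (ht δ hδ0 hδ1 (v + δ) (by linarith)).1
    rw [add_sub_cancel_right, hxv] at h1
    have h2 : C / ((v + δ) ^ (2 * q) * δ) ≤ C * δ := by
      calc C / ((v + δ) ^ (2 * q) * δ) ≤ C / (v ^ (2 * q) * δ) := by
            gcongr; linarith
        _ = C * δ := by rw [hqd, div_inv_eq_mul]
    have h4 : Real.exp (-(v + δ + δ)) = Real.exp (-(2 * δ)) / x := by
      rw [← hxv, ← Real.exp_sub]; congr 1; ring
    rw [h4] at h1
    have h5 : Real.exp (-(2 * δ)) / x * Chebyshev.psi x ≤ 1 + C * δ := by linarith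
    have h6 : 1 - 2 * δ ≤ Real.exp (-(2 * δ)) := by
      have := Real.add_one_le_exp (-(2 * δ)); linarith
    have h7 : Real.exp (2 * δ) ≤ K := Real.exp_le_exp.2 (by linarith)
    have h8 : Chebyshev.psi x ≤ Real.exp (2 * δ) * (1 + C * δ) * x := by
      calc Chebyshev.psi x = Real.exp (2 * δ) * (Real.exp (-(2 * δ)) / x * Chebyshev.psi x) * x := by rw [Real.exp_neg]; field_simp
        _ ≤ _ := by gcongr
    have h9 : Real.exp (2 * δ) ≤ 1 + 2 * K * δ := by
      have h := mul_le_mul_of_nonneg_left h6 (Real.exp_pos (2 * δ)).le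
      rw [← Real.exp_add, add_neg_cancel, Real.exp_zero] at h
      have : Real.exp (2 * δ) * (2 * δ) ≤ K * (2 * δ) := by gcongr
      linarith
    have h10 : Real.exp (2 * δ) * (1 + C * δ) * x ≤ (1 + 2 * K * δ) * (1 + C * δ) * x := by gcongr
    have h12 : 2 * K * C * (δ * δ) * x ≤ 2 * K * C * (δ * 1) * x := by gcongr
    have h11 : 0 ≤ (7 * 3 ^ q + (2 + D)) * (x * δ) := by positivity
    linarith

lemma theta_bound (q : ℕ) : ∃ C : ℝ, 0 < C ∧ ∀ x : ℝ, 1 < x → |Chebyshev.theta x - x| ≤ C * (x / Real.log x ^ q) := by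
  obtain ⟨C, hC, h⟩ := psi_bound q
  obtain ⟨A, hA⟩ : ∃ A : ℝ, ∀ x : ℝ, 1 < x → Real.log x ^ (q + 1) ≤ A * Real.sqrt x := by
    refine ⟨(2 * (q + 1)) ^ (q + 1), fun x hx => ?_⟩
    have h1 := Real.log_le_rpow_div (x := x) (by linarith) (ε := 1 / (2 * (q + 1))) (by positivity)
    have h0 := Real.log_nonneg hx.le
    calc Real.log x ^ (q+1) ≤ (x ^ (1 / (2 * (q + 1)) : ℝ) / (1 / (2 * (q + 1)))) ^ (q + 1) := by gcongr
      _ = (2 * (q + 1)) ^ (q + 1) * Real.sqrt x := by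
        rw [div_div_eq_mul_div, div_one, mul_pow, ← Real.rpow_natCast, ← Real.rpow_mul (by linarith), Real.sqrt_eq_rpow, mul_comm]
        congr 2
        push_cast; field_simp
  have hA0 : 0 ≤ A := by
    have h1 := hA (Real.exp 1) (by simp)
    rw [Real.log_exp, one_pow] at h1
    by_contra hneg
    push Not at hneg
    nlinarith [Real.sqrt_nonneg (Real.exp 1)]
  refine ⟨C + 2 * A, by positivity, fun x hx => ?_⟩
  have hl := Real.log_pos hx
  have h1 := h x hx
  have h2 := Chebyshev.abs_psi_sub_theta_le_sqrt_mul_log hx.le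
  have h3 : 2 * Real.sqrt x * Real.log x ≤ 2 * A * (x / Real.log x ^ q) := by
    rw [← mul_div_assoc, le_div_iff₀ (by positivity)]
    have h4 := mul_le_mul_of_nonneg_left (hA x hx) (Real.sqrt_nonneg x)
    have h5 := Real.mul_self_sqrt (by linarith : 0 ≤ x)
    rw [pow_succ] at h4
    nlinarith
  have h6 : |Chebyshev.theta x - x| ≤ |Chebyshev.psi x - Chebyshev.theta x| + |Chebyshev.psi x - x| := by
    rw [abs_sub_comm (Chebyshev.psi x) (Chebyshev.theta x)]
    exact abs_sub_le _ _ _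
  rw [add_mul]
  linarith

end PNT

end PartPA6

section PartPB1

open Set MeasureTheory Filter Topology

namespace PNT

lemma log_two_gt_half : (1/2 : ℝ) < Real.log 2 := by
  have := Real.log_two_gt_d9; linarith

lemma half_lt_log {t : ℝ} (ht : 2 ≤ t) : (1/2 : ℝ) < Real.log t :=
  log_two_gt_half.trans_le (Real.log_le_log (by norm_num) ht)

lemma quasi_mono (k : ℕ) : ∃ B : ℝ, 0 < B ∧ ∀ t x : ℝ, 2 ≤ t → t ≤ x →
    Real.sqrt t / Real.log t ^ k ≤ B * (Real.sqrt x / Real.log x ^ k) := by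
  refine ⟨(4 * (k + 1)) ^ k, by positivity, fun t x ht htx => ?_⟩
  have ht0 : 0 < t := by linarith
  have hx0 : 0 < x := by linarith
  have hlt := half_lt_log ht
  have hlx := half_lt_log (ht.trans htx)
  set y := Real.log (x / t) with hy
  have hy0 : 0 ≤ y := Real.log_nonneg ((one_le_div ht0).2 htx)
  have hxy : Real.log x = Real.log t + y := by rw [hy, Real.log_div hx0.ne' ht0.ne']; ring
  have h1 : Real.log x / Real.log t ≤ 4 * (k + 1) * Real.exp (y / (2 * (k + 1))) := by
    have h2 := Real.add_one_le_exp (y / (2 * (k + 1)))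
    have h3 : Real.log x / Real.log t ≤ 1 + 2 * y := by
      rw [div_le_iff₀ (by linarith), hxy]; nlinarith
    have h4 : 4 * (k + 1) * (y / (2 * (k + 1)) + 1) = 2 * y + 4 * (k + 1 : ℝ) := by field_simp; ring
    have h5 : 4 * (k + 1) * (y / (2 * (k + 1)) + 1) ≤ 4 * (k + 1) * Real.exp (y / (2 * (k + 1))) := by gcongr
    have : (0:ℝ) ≤ k := Nat.cast_nonneg k
    linarith
  have h6 : (Real.log x / Real.log t) ^ k ≤ (4 * (k + 1)) ^ k * Real.sqrt (x / t) := by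
    calc _ ≤ (4 * (k + 1) * Real.exp (y / (2 * (k + 1)))) ^ k := by
          have : 0 ≤ Real.log x / Real.log t := by positivity
          gcongr
      _ = (4 * (k + 1)) ^ k * Real.exp (k * (y / (2 * (k + 1)))) := by rw [mul_pow, ← Real.exp_nat_mul]
      _ ≤ (4 * (k + 1)) ^ k * Real.exp (y / 2) := by
          gcongr
          rw [← mul_div_assoc, div_le_div_iff₀ (by positivity) (by norm_num)]
          nlinarith
      _ = _ := by rw [Real.exp_half, hy, Real.exp_log (by positivity)]
  rw [Real.sqrt_div hx0.le, div_pow] at h6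
  rw [← mul_div_assoc, div_le_div_iff₀ (by positivity) (by positivity)]
  rw [← mul_div_assoc, div_le_div_iff₀ (by positivity) (by positivity)] at h6
  linarith

/-- `h(2) ≤ B h(x)` -/
lemma const_le (d k : ℕ) : ∃ B : ℝ, 0 < B ∧ ∀ x : ℝ, 2 ≤ x → 1 ≤ B * (x ^ (d + 1) / Real.log x ^ k) := by
  obtain ⟨B, hB, h⟩ := quasi_mono k
  have hl2 := log_two_gt_half
  refine ⟨B / (Real.sqrt 2 / Real.log 2 ^ k), by positivity, fun x hx => ?_⟩
  have hlx := half_lt_log hx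
  have h1 := h 2 x le_rfl hx
  have h2 : Real.sqrt x ≤ x ^ (d + 1) := by
    calc Real.sqrt x ≤ x := by
          rw [Real.sqrt_le_left (by linarith)]; nlinarith
      _ = x ^ 1 := (pow_one x).symm
      _ ≤ x ^ (d + 1) := pow_le_pow_right₀ (by linarith) (by omega)
  rw [div_mul_eq_mul_div, le_div_iff₀ (by positivity), one_mul]
  refine h1.trans ?_
  gcongr

lemma contOn_aux (d k : ℕ) (x : ℝ) : ContinuousOn (fun t : ℝ => t ^ d / Real.log t ^ k) (Icc 2 x) := by
  intro t ht
  have h1 := half_lt_log ht.1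
  have h2 : t ≠ 0 := by linarith [ht.1]
  have h3 : Real.log t ^ k ≠ 0 := by positivity
  exact ContinuousAt.continuousWithinAt (by fun_prop (disch := assumption))

lemma intInt_aux (d k : ℕ) {x : ℝ} (hx : 2 ≤ x) : IntervalIntegrable (fun t : ℝ => t ^ d / Real.log t ^ k) volume 2 x := by
  apply ContinuousOn.intervalIntegrable
  rw [uIcc_of_le hx]; exact contOn_aux d k x

lemma J_bound (d k : ℕ) : ∃ B : ℝ, 0 < B ∧ ∀ x : ℝ, 2 ≤ x →
    ∫ t in (2:ℝ)..x, t ^ d / Real.log t ^ k ≤ B * (x ^ (d + 1) / Real.log x ^ k) := by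
  obtain ⟨B, hB, h⟩ := quasi_mono k
  refine ⟨2 * B, by positivity, fun x hx => ?_⟩
  have hlx := half_lt_log hx
  have hx0 : 0 < x := by linarith
  set A := B * (Real.sqrt x / Real.log x ^ k) * x ^ d with hA
  have hA0 : 0 ≤ A := by positivity
  have hder : ∀ t ∈ uIcc 2 x, HasDerivAt (fun t => 2 * A * Real.sqrt t) (A / Real.sqrt t) t := by
    intro t ht
    rw [uIcc_of_le hx] at ht
    have ht0 : 0 < t := by linarith [ht.1]
    have := (Real.hasDerivAt_sqrt ht0.ne').const_mul (2 * A)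
    refine this.congr_deriv ?_
    have : Real.sqrt t ≠ 0 := by positivity
    field_simp
  have hci : IntervalIntegrable (fun t => A / Real.sqrt t) volume 2 x := by
    apply ContinuousOn.intervalIntegrable
    rw [uIcc_of_le hx]
    intro t ht
    have : Real.sqrt t ≠ 0 := by
      have : 0 < t := by linarith [ht.1]
      positivity
    exact ContinuousAt.continuousWithinAt (by fun_prop (disch := assumption))
  have h1 := intervalIntegral.integral_eq_sub_of_hasDerivAt hder hci
  have h2 : ∫ t in (2:ℝ)..x, t ^ d / Real.log t ^ k ≤ ∫ t in (2:ℝ)..x, A / Real.sqrt t := by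
    refine intervalIntegral.integral_mono_on hx (intInt_aux d k hx) hci fun t ht => ?_
    have ht0 : 0 < t := by linarith [ht.1]
    have hlt := half_lt_log ht.1
    have h3 := h t x ht.1 ht.2
    rw [le_div_iff₀ (by positivity)]
    calc t ^ d / Real.log t ^ k * Real.sqrt t = (Real.sqrt t / Real.log t ^ k) * t ^ d := by ring
      _ ≤ A := by
        rw [hA]
        have := ht.2
        gcongr
  refine h2.trans ?_
  rw [h1]
  have h4 : 0 ≤ 2 * A * Real.sqrt 2 := by positivity
  have h5 : 2 * A * Real.sqrt x = 2 * B * (x ^ (d + 1) / Real.log x ^ k) := by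
    have := Real.mul_self_sqrt hx0.le
    rw [hA, pow_succ]
    linear_combination (2 * B * x ^ d / Real.log x ^ k) * this
  linarith

/-- the derivative of `t^d / log t` -/
noncomputable def fd' (d : ℕ) (t : ℝ) : ℝ := d * t ^ (d - 1) / Real.log t - t ^ d * (t⁻¹ / Real.log t ^ 2)

lemma fd_hasDeriv (d : ℕ) {t : ℝ} (ht : 2 ≤ t) : HasDerivAt (fun t : ℝ => t ^ d / Real.log t) (fd' d t) t := by
  have h1 := half_lt_log ht
  have h2 : t ≠ 0 := by linarith
  have := (hasDerivAt_pow d t).div (Real.hasDerivAt_log h2) (by linarith)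
  refine HasDerivAt.congr_deriv this ?_
  rw [fd']
  have : Real.log t ≠ 0 := by linarith
  field_simp

lemma fd_bound (d : ℕ) {t : ℝ} (ht : 2 ≤ t) : t * |fd' d t| ≤ (2 * d + 4) * t ^ d := by
  have h1 := half_lt_log ht
  have h2 : 0 < t := by linarith
  have h3 : t * fd' d t = t ^ d * (d / Real.log t - 1 / Real.log t ^ 2) := by
    rw [fd']
    rcases d with _ | d
    · simp; field_simp
    · simp only [Nat.add_sub_cancel, pow_succ]; field_simp
  have h4 : |t * fd' d t| = t * |fd' d t| := by rw [abs_mul, abs_of_pos h2]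
  have h5 : 1 / Real.log t ≤ 2 := by rw [div_le_iff₀ (by linarith)]; linarith
  have h50 : 0 ≤ 1 / Real.log t := by positivity
  have h6 : |(d:ℝ) / Real.log t - 1 / Real.log t ^ 2| ≤ 2 * (d:ℝ) + 4 := by
    have e1 : (d:ℝ) / Real.log t = d * (1 / Real.log t) := by ring
    have e2 : 1 / Real.log t ^ 2 = (1 / Real.log t) ^ 2 := by ring
    rw [e1, e2, abs_le]
    have : (0:ℝ) ≤ d := Nat.cast_nonneg d
    have : (d:ℝ) * (1 / Real.log t) ≤ d * 2 := by gcongr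
    have : 0 ≤ (d:ℝ) * (1 / Real.log t) := by positivity
    constructor <;> nlinarith
  rw [← h4, h3, abs_mul, abs_of_pos (by positivity), mul_comm]
  gcongr

lemma fd_cont (d : ℕ) (x : ℝ) : ContinuousOn (fd' d) (Icc 2 x) := by
  intro t ht
  have h1 := half_lt_log ht.1
  have h2 : t ≠ 0 := by linarith [ht.1]
  have h3 : Real.log t ≠ 0 := by linarith
  have h4 : Real.log t ^ 2 ≠ 0 := by positivity
  unfold fd'
  exact ContinuousAt.continuousWithinAt (by fun_prop (disch := assumption))

/-- sum of d-th powers of primes up to x -/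
noncomputable def Sd (d : ℕ) (x : ℝ) : ℝ := ∑ n ∈ Finset.Icc 0 ⌊x⌋₊, if n.Prime then (n:ℝ) ^ d else 0

lemma Sd_abel (d : ℕ) {x : ℝ} (hx : 2 ≤ x) : Sd d x = x ^ d / Real.log x * Chebyshev.theta x - ∫ t in (2:ℝ)..x, fd' d t * Chebyshev.theta t := by
  let a : ℕ → ℝ := fun n => if n.Prime then Real.log n else 0
  have hth : ∀ t : ℝ, ∑ k ∈ Finset.Icc 0 ⌊t⌋₊, a k = Chebyshev.theta t := fun t => by
    rw [Chebyshev.theta_eq_sum_Icc, Finset.sum_filter]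
  have h := sum_mul_eq_sub_integral_mul₁ a (f := fun t : ℝ => t ^ d / Real.log t) (by simp [a]) (by simp [a]) x
    (fun t ht => (fd_hasDeriv d ht.1).differentiableAt)
    (by
      refine (fd_cont d x).integrableOn_Icc.congr_fun (fun t ht => ?_) measurableSet_Icc
      exact (fd_hasDeriv d ht.1).deriv.symm)
  simp only [hth] at h
  rw [Sd]
  trans ∑ k ∈ Finset.Icc 0 ⌊x⌋₊, (k:ℝ) ^ d / Real.log k * a k
  · refine Finset.sum_congr rfl fun n _ => ?_
    by_cases hn : n.Prime
    · have : Real.log n ≠ 0 := by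
        have : (1:ℝ) < n := by exact_mod_cast hn.one_lt
        exact (Real.log_pos this).ne'
      simp only [a, hn, if_true]; field_simp
    · simp [a, hn]
  rw [h, intervalIntegral.integral_of_le hx]
  congr 1
  refine setIntegral_congr_fun measurableSet_Ioc fun t ht => ?_
  rw [(fd_hasDeriv d ht.1.le).deriv]

/-- main term -/
noncomputable def Fd (d K : ℕ) (x : ℝ) : ℝ := ∑ j ∈ Finset.range K, (j.factorial : ℝ) / (d + 1) ^ (j + 1) * (x ^ (d + 1) / Real.log x ^ (j + 1))

lemma Fd_hasDeriv (d K : ℕ) {t : ℝ} (ht : 2 ≤ t) : HasDerivAt (Fd d K)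
    (t ^ d / Real.log t - (K.factorial : ℝ) / (d + 1) ^ K * (t ^ d / Real.log t ^ (K + 1))) t := by
  have h1 := half_lt_log ht
  have h2 : t ≠ 0 := by linarith
  have h3 : Real.log t ≠ 0 := by linarith
  induction K with
  | zero =>
    have : Fd d 0 = fun _ => 0 := by funext x; simp [Fd]
    rw [this]
    simpa using hasDerivAt_const t (0:ℝ)
  | succ K ih =>
    have e : Fd d (K+1) = fun x => Fd d K x + (K.factorial : ℝ) / (d + 1) ^ (K + 1) * (x ^ (d + 1) / Real.log x ^ (K + 1)) := by
      funext x; simp [Fd, Finset.sum_range_succ]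
    rw [e]
    have hp := ((hasDerivAt_pow (d+1) t).div ((Real.hasDerivAt_log h2).pow (K+1)) (pow_ne_zero _ h3)).const_mul ((K.factorial : ℝ) / (d + 1) ^ (K + 1))
    refine HasDerivAt.congr_deriv (ih.add hp) ?_
    simp only [Pi.pow_apply]
    rw [Nat.factorial_succ]
    push_cast
    have : (d:ℝ) + 1 ≠ 0 := by positivity
    field_simp
    ring

theorem Sd_asymp (d K : ℕ) : ∃ C : ℝ, 0 < C ∧ ∀ x : ℝ, 2 ≤ x → |Sd d x - Fd d K x| ≤ C * (x ^ (d + 1) / Real.log x ^ (K + 1)) := by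
  obtain ⟨C, hC, hth⟩ := theta_bound (K + 1)
  obtain ⟨B, hB, hJ⟩ := J_bound d (K + 1)
  obtain ⟨A, hA, hcon⟩ := const_le d (K + 1)
  set κ : ℝ := (K.factorial : ℝ) / (d + 1) ^ K with hκ
  have hκ0 : 0 ≤ κ := by positivity
  set c0 : ℝ := 2 * (2 ^ d / Real.log 2) - Fd d K 2 with hc0
  refine ⟨2 * C + (2 * d + 4) * C * B + κ * B + |c0| * A, by positivity, fun x hx => ?_⟩
  have hx0 : 0 < x := by linarith
  have hlx := half_lt_log hx
  set h := x ^ (d + 1) / Real.log x ^ (K + 1) with hh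
  have hh0 : 0 < h := by positivity
  have hfi : IntervalIntegrable (fd' d) volume 2 x := by
    apply ContinuousOn.intervalIntegrable; rw [uIcc_of_le hx]; exact fd_cont d x
  have htfi : IntervalIntegrable (fun t => t * fd' d t) volume 2 x := by
    apply ContinuousOn.intervalIntegrable; rw [uIcc_of_le hx]; exact continuousOn_id.mul (fd_cont d x)
  have hfth : IntervalIntegrable (fun t => fd' d t * Chebyshev.theta t) volume 2 x := by
    refine IntervalIntegrable.continuousOn_mul ?_ (by rw [uIcc_of_le hx]; exact fd_cont d x)
    exact Chebyshev.theta_mono.intervalIntegrable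
  have hFTC : ∫ t in (2:ℝ)..x, (t * fd' d t + κ * (t ^ d / Real.log t ^ (K + 1))) = (x * (x ^ d / Real.log x) - Fd d K x) - c0 := by
    refine intervalIntegral.integral_eq_sub_of_hasDerivAt (f := fun t => t * (t ^ d / Real.log t) - Fd d K t) (fun t ht => ?_) (htfi.add ((intInt_aux d (K+1) hx).const_mul κ))
    rw [uIcc_of_le hx] at ht
    have := ((hasDerivAt_id t).mul (fd_hasDeriv d ht.1)).sub (Fd_hasDeriv d K ht.1)
    refine HasDerivAt.congr_deriv this ?_
    simp only [hκ, id]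
    ring
  rw [intervalIntegral.integral_add htfi ((intInt_aux d (K+1) hx).const_mul κ), intervalIntegral.integral_const_mul] at hFTC
  have hsplit : ∫ t in (2:ℝ)..x, fd' d t * (Chebyshev.theta t - t) = (∫ t in (2:ℝ)..x, fd' d t * Chebyshev.theta t) - ∫ t in (2:ℝ)..x, t * fd' d t := by
    rw [← intervalIntegral.integral_sub hfth htfi]
    congr 1; funext t; ring
  have key : Sd d x - Fd d K x = x ^ d / Real.log x * (Chebyshev.theta x - x) - (∫ t in (2:ℝ)..x, fd' d t * (Chebyshev.theta t - t))
      + κ * (∫ t in (2:ℝ)..x, t ^ d / Real.log t ^ (K + 1)) + c0 := by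
    rw [Sd_abel d hx, hsplit]; linarith
  have b1 : |x ^ d / Real.log x * (Chebyshev.theta x - x)| ≤ 2 * C * h := by
    rw [abs_mul, abs_of_pos (by positivity)]
    have e1 := hth x (by linarith)
    have e2 : x ^ d / Real.log x ≤ 2 * x ^ d := by
      rw [div_le_iff₀ (by linarith)]
      have : 0 < x ^ d := by positivity
      nlinarith
    calc _ ≤ 2 * x ^ d * (C * (x / Real.log x ^ (K + 1))) := by gcongr
      _ = _ := by rw [hh, pow_succ x d]; ring
  have b2 : |∫ t in (2:ℝ)..x, fd' d t * (Chebyshev.theta t - t)| ≤ (2 * d + 4) * C * B * h := by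
    have e1 : ‖∫ t in (2:ℝ)..x, fd' d t * (Chebyshev.theta t - t)‖ ≤ ∫ t in (2:ℝ)..x, (2 * d + 4) * C * (t ^ d / Real.log t ^ (K + 1)) := by
      refine intervalIntegral.norm_integral_le_of_norm_le hx (Eventually.of_forall fun t ht => ?_) ((intInt_aux d (K+1) hx).const_mul _)
      have ht2 : 2 ≤ t := ht.1.le
      have hlt := half_lt_log ht2
      have ht0 : 0 < t := by linarith
      rw [norm_mul, Real.norm_eq_abs, Real.norm_eq_abs]
      calc |fd' d t| * |Chebyshev.theta t - t| ≤ |fd' d t| * (C * (t / Real.log t ^ (K + 1))) := by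
            gcongr; exact hth t (by linarith)
        _ = (t * |fd' d t|) * (C / Real.log t ^ (K + 1)) := by ring
        _ ≤ ((2 * d + 4) * t ^ d) * (C / Real.log t ^ (K + 1)) := by
            refine mul_le_mul_of_nonneg_right (fd_bound d ht2) (by positivity)
        _ = _ := by ring
    rw [intervalIntegral.integral_const_mul] at e1
    rw [← Real.norm_eq_abs]
    refine e1.trans ?_
    rw [mul_assoc _ B h]
    have := hJ x hx
    gcongr
  have b3 : |κ * (∫ t in (2:ℝ)..x, t ^ d / Real.log t ^ (K + 1))| ≤ κ * B * h := by
    have e0 : 0 ≤ ∫ t in (2:ℝ)..x, t ^ d / Real.log t ^ (K + 1) := by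
      refine intervalIntegral.integral_nonneg hx fun t ht => ?_
      have hlt := half_lt_log ht.1
      have : 0 < t := by linarith [ht.1]
      positivity
    rw [abs_of_nonneg (mul_nonneg hκ0 e0), mul_assoc]
    have := hJ x hx
    gcongr
  have b4 : |c0| ≤ |c0| * A * h := by
    have := hcon x hx
    rw [mul_assoc]
    exact le_mul_of_one_le_right (abs_nonneg _) this
  rw [key]
  refine (abs_add_le _ _).trans ?_
  have t1 := abs_add_le (x ^ d / Real.log x * (Chebyshev.theta x - x) - (∫ t in (2:ℝ)..x, fd' d t * (Chebyshev.theta t - t))) (κ * (∫ t in (2:ℝ)..x, t ^ d / Real.log t ^ (K + 1)))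
  have t2 := abs_sub (x ^ d / Real.log x * (Chebyshev.theta x - x)) (∫ t in (2:ℝ)..x, fd' d t * (Chebyshev.theta t - t))
  nlinarith

end PNT

end PartPB1

section PartPB2

open Set MeasureTheory Filter Topology Asymptotics

namespace PNT

/-- `log log n / log n` -/
noncomputable def tt (n : ℕ) : ℝ := Real.log (Real.log n) / Real.log n
/-- `1 / log n` -/
noncomputable def ta (n : ℕ) : ℝ := 1 / Real.log n

lemma tendsto_lg : Tendsto (fun n : ℕ => Real.log n) atTop atTop :=
  Real.tendsto_log_atTop.comp tendsto_natCast_atTop_atTop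

lemma tendsto_ll : Tendsto (fun n : ℕ => Real.log (Real.log n)) atTop atTop :=
  Real.tendsto_log_atTop.comp tendsto_lg

lemma tendsto_tt : Tendsto tt atTop (𝓝 0) := by
  have h : Tendsto (fun x : ℝ => Real.log x / x) atTop (𝓝 0) :=
    Real.isLittleO_log_id_atTop.tendsto_div_nhds_zero
  exact h.comp tendsto_lg

lemma tendsto_ta : Tendsto ta atTop (𝓝 0) := by
  have := tendsto_lg.inv_tendsto_atTop
  refine this.congr fun n => ?_
  simp [ta]

lemma ta_O_tt : ta =O[atTop] tt := by
  refine IsBigO.of_bound 1 ?_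
  filter_upwards [tendsto_lg.eventually_ge_atTop 1, tendsto_ll.eventually_ge_atTop 1] with n h1 h2
  have h3 : 0 < Real.log (n : ℝ) := by linarith
  rw [one_mul, ta, tt, Real.norm_of_nonneg (by positivity), Real.norm_of_nonneg (by positivity)]
  gcongr

lemma tt_O_one : tt =O[atTop] (fun _ => (1 : ℝ)) := tendsto_tt.isBigO_one ℝ
lemma ta_O_one : ta =O[atTop] (fun _ => (1 : ℝ)) := tendsto_ta.isBigO_one ℝ

lemma tt_pow_mono {a b : ℕ} (h : a ≤ b) :
    (fun n => tt n ^ b) =O[atTop] (fun n => tt n ^ a) := by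
  obtain ⟨c, rfl⟩ := Nat.exists_eq_add_of_le h
  have := (isBigO_refl (fun n => tt n ^ a) atTop).mul (tt_O_one.pow c)
  simpa [pow_add] using this

/-- congruence modulo `tt ^ (k+1)` -/
def Cg (k : ℕ) (f g : ℕ → ℝ) : Prop :=
  (fun n => f n - g n) =O[atTop] fun n => tt n ^ (k + 1)

lemma Cg.refl (k : ℕ) (f : ℕ → ℝ) : Cg k f f := by
  unfold Cg; simpa using isBigO_zero _ _

lemma Cg.trans {k : ℕ} {f g h : ℕ → ℝ} (h1 : Cg k f g) (h2 : Cg k g h) : Cg k f h := by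
  unfold Cg at *
  refine (h1.add h2).congr_left fun n => by ring

lemma Cg.symm {k : ℕ} {f g : ℕ → ℝ} (h1 : Cg k f g) : Cg k g f := by
  unfold Cg at *
  refine h1.neg_left.congr_left fun n => by ring

lemma Cg.add {k : ℕ} {f g f' g' : ℕ → ℝ} (h1 : Cg k f g) (h2 : Cg k f' g') :
    Cg k (fun n => f n + f' n) (fun n => g n + g' n) := by
  unfold Cg at *
  refine (h1.add h2).congr_left fun n => by ring

lemma Cg.sub {k : ℕ} {f g f' g' : ℕ → ℝ} (h1 : Cg k f g) (h2 : Cg k f' g') :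
    Cg k (fun n => f n - f' n) (fun n => g n - g' n) := by
  unfold Cg at *
  refine (h1.sub h2).congr_left fun n => by ring

lemma Cg.bdd {k : ℕ} {f g : ℕ → ℝ} (h1 : Cg k f g) (h : g =O[atTop] (fun _ => (1 : ℝ))) :
    f =O[atTop] (fun _ => (1 : ℝ)) := by
  have h2 : (fun n => f n - g n) =O[atTop] (fun _ => (1 : ℝ)) :=
    IsBigO.trans h1 (by simpa using tt_O_one.pow (k + 1))
  refine (h2.add h).congr_left fun n => by ring

lemma Cg.mul {k : ℕ} {f g f' g' : ℕ → ℝ} (h1 : Cg k f g) (h2 : Cg k f' g')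
    (hg : g =O[atTop] (fun _ => (1 : ℝ))) (hg' : g' =O[atTop] (fun _ => (1 : ℝ))) :
    Cg k (fun n => f n * f' n) (fun n => g n * g' n) := by
  have hf := h1.bdd hg
  unfold Cg at *
  have a1 := hf.mul h2
  have a2 := h1.mul hg'
  simp only [one_mul, mul_one] at a1 a2
  refine (a1.add a2).congr_left fun n => by ring

lemma Cg.ta_mul {k : ℕ} {f g : ℕ → ℝ} (h1 : Cg k f g) :
    Cg (k + 1) (fun n => ta n * f n) (fun n => ta n * g n) := by
  unfold Cg at *
  refine (ta_O_tt.mul h1).congr (fun n => by ring) (fun n => by ring)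

lemma Cg.mono {k l : ℕ} (hkl : k ≤ l) {f g : ℕ → ℝ} (h1 : Cg l f g) : Cg k f g :=
  IsBigO.trans h1 (tt_pow_mono (by omega))

lemma Cg.congr' {k : ℕ} {f g f' : ℕ → ℝ} (h1 : Cg k f g) (h : f =ᶠ[atTop] f') : Cg k f' g := by
  unfold Cg at *
  refine h1.congr' ?_ EventuallyEq.rfl
  filter_upwards [h] with n hn
  rw [hn]

/-- evaluation of bivariate polynomial at `(tt n, ta n)`; the outer variable is `ta`. -/
noncomputable def ev (n : ℕ) : Polynomial (Polynomial ℚ) →+* ℝ :=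
  Polynomial.eval₂RingHom
    ((Polynomial.aeval (tt n) : Polynomial ℚ →ₐ[ℚ] ℝ) : Polynomial ℚ →+* ℝ) (ta n)

lemma ev_C (n : ℕ) (q : Polynomial ℚ) : ev n (Polynomial.C q) = Polynomial.aeval (tt n) q := by
  simp [ev]

lemma ev_X (n : ℕ) : ev n Polynomial.X = ta n := by
  simp [ev]

lemma aeval_bdd {f : ℕ → ℝ} (hf : f =O[atTop] (fun _ => (1 : ℝ))) (q : Polynomial ℚ) :
    (fun n => Polynomial.aeval (f n) q) =O[atTop] (fun _ => (1 : ℝ)) := by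
  induction q using Polynomial.induction_on' with
  | add p q hp hq => simpa using hp.add hq
  | monomial i a =>
    simp only [Polynomial.aeval_monomial]
    simpa using (hf.pow i).const_mul_left ((algebraMap ℚ ℝ) a)

lemma ev_bdd (p : Polynomial (Polynomial ℚ)) :
    (fun n => ev n p) =O[atTop] (fun _ => (1 : ℝ)) := by
  induction p using Polynomial.induction_on' with
  | add p q hp hq => simpa using hp.add hq
  | monomial i a =>
    have : ∀ n, ev n (Polynomial.monomial i a) = Polynomial.aeval (tt n) a * ta n ^ i := by
      intro n
      rw [← Polynomial.C_mul_X_pow_eq_monomial, map_mul, map_pow, ev_C, ev_X]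
    simp only [this]
    simpa using (aeval_bdd tt_O_one a).mul (ta_O_one.pow i)

/-- `f` has an expansion of order `k` with top symbol `g` -/
def Ex (k : ℕ) (f : ℕ → ℝ) (g : Polynomial ℚ) : Prop :=
  ∃ p : Polynomial (Polynomial ℚ), p.coeff 0 = g ∧ Cg k f (fun n => ev n p)

lemma Ex.congr {k : ℕ} {f f' : ℕ → ℝ} {g} (h : Ex k f g) (h' : Cg k f' f) : Ex k f' g := by
  obtain ⟨p, hp, h⟩ := h
  exact ⟨p, hp, h'.trans h⟩

lemma Ex.congr' {k : ℕ} {f f' : ℕ → ℝ} {g} (h : Ex k f g) (h' : f =ᶠ[atTop] f') : Ex k f' g := by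
  obtain ⟨p, hp, h⟩ := h
  exact ⟨p, hp, h.congr' h'⟩

lemma Ex.bdd {k : ℕ} {f : ℕ → ℝ} {g} (h : Ex k f g) : f =O[atTop] (fun _ => (1 : ℝ)) := by
  obtain ⟨p, hp, h⟩ := h
  exact h.bdd (ev_bdd p)

lemma Ex_const (k : ℕ) (q : ℚ) : Ex k (fun _ => (q : ℝ)) (Polynomial.C q) := by
  refine ⟨Polynomial.C (Polynomial.C q), by simp, ?_⟩
  simp only [ev_C, Polynomial.aeval_C]
  exact Cg.refl _ _

lemma Ex_tt (k : ℕ) : Ex k tt Polynomial.X := by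
  refine ⟨Polynomial.C Polynomial.X, by simp, ?_⟩
  simp only [ev_C, Polynomial.aeval_X]
  exact Cg.refl _ _

lemma Ex_ta (k : ℕ) : Ex k ta 0 := by
  refine ⟨Polynomial.X, by simp, ?_⟩
  simp only [ev_X]
  exact Cg.refl _ _

lemma Ex.add {k : ℕ} {f f' : ℕ → ℝ} {g g'} (h : Ex k f g) (h' : Ex k f' g') :
    Ex k (fun n => f n + f' n) (g + g') := by
  obtain ⟨p, hp, h⟩ := h
  obtain ⟨p', hp', h'⟩ := h'
  refine ⟨p + p', by simp [hp, hp'], ?_⟩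
  simpa using h.add h'

lemma Ex.sub {k : ℕ} {f f' : ℕ → ℝ} {g g'} (h : Ex k f g) (h' : Ex k f' g') :
    Ex k (fun n => f n - f' n) (g - g') := by
  obtain ⟨p, hp, h⟩ := h
  obtain ⟨p', hp', h'⟩ := h'
  refine ⟨p - p', by simp [hp, hp'], ?_⟩
  simpa using h.sub h'

lemma Ex.mul {k : ℕ} {f f' : ℕ → ℝ} {g g'} (h : Ex k f g) (h' : Ex k f' g') :
    Ex k (fun n => f n * f' n) (g * g') := by
  obtain ⟨p, hp, h⟩ := h
  obtain ⟨p', hp', h'⟩ := h'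
  refine ⟨p * p', by simp [hp, hp', Polynomial.mul_coeff_zero], ?_⟩
  simpa using h.mul h' (ev_bdd p) (ev_bdd p')

lemma Ex.ta_mul {k : ℕ} {f : ℕ → ℝ} {g} (h : Ex k f g) :
    Ex (k + 1) (fun n => ta n * f n) 0 := by
  obtain ⟨p, hp, h⟩ := h
  refine ⟨Polynomial.X * p, by simp, ?_⟩
  simpa [ev_X] using h.ta_mul

lemma Ex.pow {k : ℕ} {f : ℕ → ℝ} {g} (h : Ex k f g) (i : ℕ) :
    Ex k (fun n => f n ^ i) (g ^ i) := by
  induction i with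
  | zero => simpa using Ex_const k 1
  | succ i ih => simpa [pow_succ] using ih.mul h

lemma Ex.poly {k : ℕ} {f : ℕ → ℝ} {g} (h : Ex k f g) (q : Polynomial ℚ) :
    Ex k (fun n => Polynomial.aeval (f n) q) (q.comp g) := by
  induction q using Polynomial.induction_on' with
  | add p q hp hq => simpa using hp.add hq
  | monomial i a =>
    simp only [Polynomial.aeval_monomial, Polynomial.monomial_comp]
    exact (Ex_const k a).mul (h.pow i)

lemma Ex.comp {k : ℕ} {f : ℕ → ℝ} {g} (h : Ex k f g) (hf : f =O[atTop] tt) (q : Polynomial ℚ)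
    (φ : ℝ → ℝ) (hφ : (fun u => φ u - Polynomial.aeval u q) =O[𝓝 0] fun u => u ^ (k + 1)) :
    Ex k (fun n => φ (f n)) (q.comp g) := by
  refine (h.poly q).congr ?_
  have ht : Tendsto f atTop (𝓝 0) := hf.trans_tendsto tendsto_tt
  exact (hφ.comp_tendsto ht).trans (hf.pow (k + 1))

/-- Taylor polynomial of `log (1+u)` -/
noncomputable def logP (k : ℕ) : Polynomial ℚ :=
  ∑ i ∈ Finset.range k, Polynomial.C ((-1 : ℚ) ^ i / (i + 1)) * Polynomial.X ^ (i + 1)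

/-- Taylor polynomial of `1/(1+u)` -/
noncomputable def invP (k : ℕ) : Polynomial ℚ :=
  ∑ i ∈ Finset.range (k + 1), Polynomial.C ((-1 : ℚ) ^ i) * Polynomial.X ^ i

lemma log_taylor (k : ℕ) :
    (fun u => Real.log (1 + u) - Polynomial.aeval u (logP k)) =O[𝓝 0] fun u : ℝ => u ^ (k + 1) := by
  refine IsBigO.of_bound 2 ?_
  have : ∀ᶠ u : ℝ in 𝓝 0, |u| < 1 / 2 := by
    have := Metric.ball_mem_nhds (0 : ℝ) (show (0 : ℝ) < 1 / 2 by norm_num)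
    filter_upwards [this] with u hu
    simpa using hu
  filter_upwards [this] with u hu
  have h := Real.abs_log_sub_add_sum_range_le (x := -u) (by rw [abs_neg]; linarith) k
  rw [abs_neg, sub_neg_eq_add] at h
  have e : Real.log (1 + u) - Polynomial.aeval u (logP k)
      = (∑ i ∈ Finset.range k, (-u) ^ (i + 1) / (i + 1)) + Real.log (1 + u) := by
    have : Polynomial.aeval u (logP k) = -(∑ i ∈ Finset.range k, (-u) ^ (i + 1) / ((i : ℝ) + 1)) := by
      simp only [logP, map_sum, map_mul, Polynomial.aeval_C, map_pow, Polynomial.aeval_X]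
      rw [← Finset.sum_neg_distrib]
      refine Finset.sum_congr rfl fun i _ => ?_
      rw [neg_pow u (i+1)]
      simp only [eq_ratCast]
      push_cast
      ring
    rw [this]; ring
  rw [e, Real.norm_eq_abs, norm_pow, Real.norm_eq_abs]
  refine h.trans ?_
  rw [div_le_iff₀ (by linarith)]
  have : 0 ≤ |u| ^ (k + 1) := by positivity
  nlinarith

lemma inv_taylor (k : ℕ) :
    (fun u => (1 + u)⁻¹ - Polynomial.aeval u (invP k)) =O[𝓝 0] fun u : ℝ => u ^ (k + 1) := by
  refine IsBigO.of_bound 2 ?_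
  have : ∀ᶠ u : ℝ in 𝓝 0, |u| < 1 / 2 := by
    have := Metric.ball_mem_nhds (0 : ℝ) (show (0 : ℝ) < 1 / 2 by norm_num)
    filter_upwards [this] with u hu
    simpa using hu
  filter_upwards [this] with u hu
  have h1 : 1 / 2 < 1 + u := by linarith [(abs_lt.mp hu).1]
  have e : (1 + u)⁻¹ - Polynomial.aeval u (invP k) = (-u) ^ (k + 1) / (1 + u) := by
    have : Polynomial.aeval u (invP k) = ∑ i ∈ Finset.range (k + 1), (-u) ^ i := by
      simp only [invP, map_sum, map_mul, Polynomial.aeval_C, map_pow, Polynomial.aeval_X]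
      refine Finset.sum_congr rfl fun i _ => ?_
      rw [neg_pow u i]
      simp
    rw [this, geom_sum_eq (by linarith)]
    have h2 : -u - 1 ≠ 0 := by linarith
    have h3 : 1 + u ≠ 0 := by linarith
    rw [show -u - 1 = -(1 + u) by ring]
    field_simp
    ring
  rw [e, norm_div, norm_pow, norm_pow, norm_neg, Real.norm_eq_abs (1 + u), abs_of_pos (by linarith)]
  rw [div_le_iff₀ (by linarith)]
  have : 0 ≤ ‖u‖ ^ (k + 1) := by positivity
  nlinarith

end PNT

end PartPB2

section PartPB3

open Set MeasureTheory Filter Topology Asymptotics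

namespace PNT

lemma sum_filter_nth (f : ℕ → ℝ) (k : ℕ) :
    ∑ i ∈ (Finset.range (Nat.nth Nat.Prime k)).filter Nat.Prime, f i =
      ∑ i ∈ Finset.range k, f (Nat.nth Nat.Prime i) := by
  induction k with
  | zero =>
    rw [Nat.nth_prime_zero_eq_two]
    have : (Finset.range 2).filter Nat.Prime = ∅ := by decide
    simp [this]
  | succ k ih =>
    rw [Nat.filter_range_nth_eq_insert_of_infinite Nat.infinite_setOfPred_prime,
      Finset.sum_insert (by simp), ih, Finset.sum_range_succ, add_comm]

/-- the `n`-th prime, as a real -/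
noncomputable def xx (n : ℕ) : ℝ := (Nat.nth Nat.Prime (n - 1) : ℝ)
/-- its logarithm -/
noncomputable def mm (n : ℕ) : ℝ := Real.log (xx n)
/-- inverse of the logarithm -/
noncomputable def ww (n : ℕ) : ℝ := 1 / mm n
/-- defined by `mm = log n (1 + zz)` -/
noncomputable def zz (n : ℕ) : ℝ := mm n / Real.log n - 1
/-- prime sum -/
noncomputable def ss (n : ℕ) : ℝ := ∑ k ∈ Finset.Icc 1 n, (Nat.nth Nat.Prime (k - 1) : ℝ)
/-- normalized `n` -/
noncomputable def al (n : ℕ) : ℝ := n * mm n / xx n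
/-- normalized prime sum -/
noncomputable def be (n : ℕ) : ℝ := 2 * ss n * mm n / xx n ^ 2

lemma Sd_xx (d n : ℕ) (hn : 1 ≤ n) :
    Sd d (xx n) = ∑ k ∈ Finset.Icc 1 n, (Nat.nth Nat.Prime (k - 1) : ℝ) ^ d := by
  obtain ⟨k, rfl⟩ := Nat.exists_eq_add_of_le hn
  have e : ∑ j ∈ Finset.Icc 1 (1 + k), (Nat.nth Nat.Prime (j - 1) : ℝ) ^ d =
      ∑ i ∈ Finset.range (k + 1), (Nat.nth Nat.Prime i : ℝ) ^ d := by
    have : Finset.Icc 1 (1 + k) = Finset.Ico 1 (k + 2) := by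
      ext i; simp only [Finset.mem_Icc, Finset.mem_Ico]; omega
    rw [this, Finset.sum_Ico_eq_sum_range]
    refine Finset.sum_congr (by simp) fun i _ => by simp
  rw [e, Sd, xx, Nat.floor_natCast, ← Finset.sum_filter]
  have : (Finset.Icc 0 (Nat.nth Nat.Prime (1 + k - 1))).filter Nat.Prime =
      (Finset.range (Nat.nth Nat.Prime (k + 1))).filter Nat.Prime := by
    rw [Nat.filter_range_nth_eq_insert_of_infinite Nat.infinite_setOfPred_prime]
    have h : Finset.Icc 0 (Nat.nth Nat.Prime (1 + k - 1)) =
        insert (Nat.nth Nat.Prime k) (Finset.range (Nat.nth Nat.Prime k)) := by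
      ext i; simp only [Finset.mem_Icc, Finset.mem_insert, Finset.mem_range, Nat.add_sub_cancel_left]
      omega
    rw [h, Finset.filter_insert, if_pos (Nat.prime_nth_prime k)]
  rw [this, sum_filter_nth (fun i => (i : ℝ) ^ d)]

lemma Sd_zero_xx (n : ℕ) (hn : 1 ≤ n) : Sd 0 (xx n) = n := by
  rw [Sd_xx 0 n hn]; simp

lemma Sd_one_xx (n : ℕ) (hn : 1 ≤ n) : Sd 1 (xx n) = ss n := by
  rw [Sd_xx 1 n hn]; simp [ss]

lemma xx_ge (n : ℕ) : (n : ℝ) ≤ xx n := by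
  have := Nat.add_two_le_nth_prime (n - 1)
  rw [xx]
  exact_mod_cast (by omega : n ≤ Nat.nth Nat.Prime (n - 1))

lemma xx_ge_two (n : ℕ) : 2 ≤ xx n := by
  have := Nat.add_two_le_nth_prime (n - 1)
  rw [xx]
  exact_mod_cast (by omega : 2 ≤ Nat.nth Nat.Prime (n - 1))

lemma mm_pos (n : ℕ) : 0 < mm n := by
  have := half_lt_log (xx_ge_two n)
  rw [mm]; linarith

lemma tendsto_mm : Tendsto mm atTop atTop :=
  Real.tendsto_log_atTop.comp (tendsto_atTop_mono xx_ge tendsto_natCast_atTop_atTop)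

lemma tendsto_ww : Tendsto ww atTop (𝓝 0) := by
  refine tendsto_mm.inv_tendsto_atTop.congr fun n => ?_
  simp [ww]

/-- `∑ j! X^j` -/
noncomputable def aP (K : ℕ) : Polynomial ℚ :=
  ∑ j ∈ Finset.range K, Polynomial.C (j.factorial : ℚ) * Polynomial.X ^ j
/-- `∑ j!/2^j X^j` -/
noncomputable def bP (K : ℕ) : Polynomial ℚ :=
  ∑ j ∈ Finset.range K, Polynomial.C ((j.factorial : ℚ) / 2 ^ j) * Polynomial.X ^ j

lemma al_asymp (K : ℕ) :
    (fun n => al n - Polynomial.aeval (ww n) (aP K)) =O[atTop] fun n => ww n ^ K := by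
  obtain ⟨C, hC, h⟩ := Sd_asymp 0 K
  refine IsBigO.of_bound C ?_
  filter_upwards [eventually_ge_atTop 1] with n hn
  have h1 := h (xx n) (xx_ge_two n)
  rw [Sd_zero_xx n hn] at h1
  have hx : 0 < xx n := by linarith [xx_ge_two n]
  have hM := mm_pos n
  have e : Polynomial.aeval (ww n) (aP K) = mm n / xx n * Fd 0 K (xx n) := by
    simp only [aP, map_sum, map_mul, Polynomial.aeval_C, map_pow, Polynomial.aeval_X, Fd,
      Finset.mul_sum]
    refine Finset.sum_congr rfl fun j _ => ?_
    rw [ww, ← mm]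
    simp
    field_simp
    ring
  have e2 : al n - Polynomial.aeval (ww n) (aP K) = mm n / xx n * (n - Fd 0 K (xx n)) := by
    rw [e, al]; ring
  rw [e2, Real.norm_eq_abs, abs_mul, abs_of_pos (by positivity)]
  calc mm n / xx n * |(n : ℝ) - Fd 0 K (xx n)|
      ≤ mm n / xx n * (C * (xx n ^ (0 + 1) / Real.log (xx n) ^ (K + 1))) := by gcongr
    _ = C * ww n ^ K := by
      rw [← mm, ww, div_pow, one_pow]; field_simp; ring
    _ ≤ C * ‖ww n ^ K‖ := by
      gcongr; exact Real.le_norm_self _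

lemma be_asymp (K : ℕ) :
    (fun n => be n - Polynomial.aeval (ww n) (bP K)) =O[atTop] fun n => ww n ^ K := by
  obtain ⟨C, hC, h⟩ := Sd_asymp 1 K
  refine IsBigO.of_bound (2 * C) ?_
  filter_upwards [eventually_ge_atTop 1] with n hn
  have h1 := h (xx n) (xx_ge_two n)
  rw [Sd_one_xx n hn] at h1
  have hx : 0 < xx n := by linarith [xx_ge_two n]
  have hM := mm_pos n
  have e : Polynomial.aeval (ww n) (bP K) = 2 * mm n / xx n ^ 2 * Fd 1 K (xx n) := by
    simp only [bP, map_sum, map_mul, Polynomial.aeval_C, map_pow, Polynomial.aeval_X, Fd,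
      Finset.mul_sum]
    refine Finset.sum_congr rfl fun j _ => ?_
    rw [ww, ← mm]
    have : ((1 : ℕ) : ℝ) + 1 = 2 := by norm_num
    rw [this]
    simp
    field_simp
    ring
  have e2 : be n - Polynomial.aeval (ww n) (bP K) = 2 * mm n / xx n ^ 2 * (ss n - Fd 1 K (xx n)) := by
    rw [e, be]; ring
  rw [e2, Real.norm_eq_abs, abs_mul, abs_of_pos (by positivity)]
  calc 2 * mm n / xx n ^ 2 * |ss n - Fd 1 K (xx n)|
      ≤ 2 * mm n / xx n ^ 2 * (C * (xx n ^ (1 + 1) / Real.log (xx n) ^ (K + 1))) := by gcongr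
    _ = 2 * C * ww n ^ K := by
      rw [← mm, ww, div_pow, one_pow]; field_simp; ring
    _ ≤ 2 * C * ‖ww n ^ K‖ := by
      gcongr; exact Real.le_norm_self _

lemma al_sub_one : (fun n => al n - 1) =O[atTop] ww := by
  have := al_asymp 1
  simpa [aP] using this

lemma tendsto_al : Tendsto al atTop (𝓝 1) := by
  have := (al_sub_one.trans_tendsto tendsto_ww).add_const 1
  simpa using this

lemma log_eq : ∀ᶠ n : ℕ in atTop, Real.log (n : ℝ) = mm n - Real.log (mm n) + Real.log (al n) := by
  filter_upwards [eventually_ge_atTop 1] with n hn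
  have hx : 0 < xx n := by linarith [xx_ge_two n]
  have hM := mm_pos n
  have hn' : (0 : ℝ) < n := by exact_mod_cast hn
  rw [al, Real.log_div (by positivity) hx.ne', Real.log_mul hn'.ne' hM.ne', mm]
  ring

lemma tendsto_logal : Tendsto (fun n => Real.log (al n)) atTop (𝓝 0) := by
  have := (Real.continuousAt_log one_ne_zero).tendsto.comp tendsto_al
  simpa [Function.comp_def] using this

lemma tendsto_zz : Tendsto zz atTop (𝓝 0) := by
  have h1 : Tendsto (fun n => Real.log (mm n) / mm n) atTop (𝓝 0) :=
    (Real.isLittleO_log_id_atTop.tendsto_div_nhds_zero).comp tendsto_mm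
  have h2 : Tendsto (fun n => 1 - Real.log (mm n) / mm n + Real.log (al n) * ww n) atTop (𝓝 1) := by
    have := (h1.const_sub 1).add (tendsto_logal.mul tendsto_ww)
    simpa using this
  have h3 : Tendsto (fun n : ℕ => Real.log n / mm n) atTop (𝓝 1) := by
    refine h2.congr' ?_
    filter_upwards [log_eq] with n hn
    have hM := mm_pos n
    rw [hn, ww]; field_simp
  have h4 := (h3.inv₀ one_ne_zero).sub_const 1
  simp only [inv_one, sub_self] at h4
  refine h4.congr fun n => ?_
  rw [zz, inv_div]

lemma zz_eq : ∀ᶠ n in atTop, zz n = tt n + ta n * (Real.log (1 + zz n) - Real.log (al n)) := by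
  filter_upwards [log_eq, tendsto_lg.eventually_ge_atTop 1] with n hn h1
  have hL : 0 < Real.log (n : ℝ) := by linarith
  have hM := mm_pos n
  have e : 1 + zz n = mm n / Real.log n := by rw [zz]; ring
  rw [e, Real.log_div hM.ne' hL.ne', zz, tt, ta]
  have : mm n = Real.log n + Real.log (mm n) - Real.log (al n) := by linarith
  field_simp
  linarith

lemma ww_eq : ∀ᶠ n in atTop, ww n = ta n * (1 + zz n)⁻¹ := by
  filter_upwards [tendsto_lg.eventually_ge_atTop 1] with n h1
  have hL : 0 < Real.log (n : ℝ) := by linarith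
  have hM := mm_pos n
  have e : 1 + zz n = mm n / Real.log n := by rw [zz]; ring
  rw [e, ww, ta]
  field_simp

lemma zz_O : zz =O[atTop] tt := by
  have h1 : Tendsto (fun n => Real.log (1 + zz n) - Real.log (al n)) atTop (𝓝 0) := by
    have h : Tendsto (fun n => 1 + zz n) atTop (𝓝 1) := by simpa using tendsto_zz.const_add 1
    have := (Real.continuousAt_log one_ne_zero).tendsto.comp h
    simp only [Real.log_one] at this
    simpa using this.sub tendsto_logal
  have h2 := ta_O_tt.mul (h1.isBigO_one ℝ)
  simp only [mul_one] at h2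
  refine ((isBigO_refl tt atTop).add h2).congr' ?_ EventuallyEq.rfl
  filter_upwards [zz_eq] with n hn
  exact hn.symm

lemma ww_O_ta : ww =O[atTop] ta := by
  have h : Tendsto (fun n => (1 + zz n)⁻¹) atTop (𝓝 1) := by
    have : Tendsto (fun n => 1 + zz n) atTop (𝓝 1) := by simpa using tendsto_zz.const_add 1
    simpa using this.inv₀ one_ne_zero
  have h2 := (isBigO_refl ta atTop).mul (h.isBigO_one ℝ)
  simp only [mul_one] at h2
  refine h2.congr' ?_ EventuallyEq.rfl
  filter_upwards [ww_eq] with n hn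
  exact hn.symm

lemma ww_O : ww =O[atTop] tt := ww_O_ta.trans ta_O_tt

lemma al_O : (fun n => al n - 1) =O[atTop] tt := al_sub_one.trans ww_O

/-- the main identity: `2 S / n² = L + ℓ + log(1+z) - log α + M (β - α²)/α²` -/
lemma main_eq : ∀ᶠ n : ℕ in atTop, 2 * ss n / (n : ℝ) ^ 2 - Real.log n - Real.log (Real.log n) =
    Real.log (1 + zz n) - Real.log (al n) + mm n * (be n - al n ^ 2) * (al n)⁻¹ ^ 2 := by
  filter_upwards [log_eq, tendsto_lg.eventually_ge_atTop 1, eventually_ge_atTop 1] with n hn h1 hn1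
  have hL : 0 < Real.log (n : ℝ) := by linarith
  have hM := mm_pos n
  have hx : 0 < xx n := by linarith [xx_ge_two n]
  have hn' : (0 : ℝ) < n := by exact_mod_cast hn1
  have e : 1 + zz n = mm n / Real.log n := by rw [zz]; ring
  have e2 : mm n * (be n - al n ^ 2) * (al n)⁻¹ ^ 2 = 2 * ss n / (n : ℝ) ^ 2 - mm n := by
    rw [be, al]; field_simp
  rw [e, Real.log_div hM.ne' hL.ne', e2]
  linarith

end PNT

end PartPB3

section PartPB4

open Set MeasureTheory Filter Topology Asymptotics

namespace PNT

lemma Ex_ww {k : ℕ} (h : Ex k zz Polynomial.X) : Ex k ww 0 := by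
  have h1 := h.comp zz_O (invP k) (fun u => (1 + u)⁻¹) (inv_taylor k)
  have h2 := (Ex_ta k).mul h1
  rw [zero_mul] at h2
  refine h2.congr' ?_
  filter_upwards [ww_eq] with n hn
  exact hn.symm

lemma aP_coeff (K i : ℕ) : (aP K).coeff i = if i < K then (i.factorial : ℚ) else 0 := by
  simp [aP, Polynomial.coeff_X_pow]

lemma bP_coeff (K i : ℕ) : (bP K).coeff i = if i < K then (i.factorial : ℚ) / 2 ^ i else 0 := by
  simp [bP, Polynomial.coeff_X_pow]

lemma Ex_al {k : ℕ} (h : Ex k ww 0) : Ex k al 1 := by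
  have h1 := h.poly (aP (k + 1))
  rw [Polynomial.comp_zero, ← Polynomial.coeff_zero_eq_eval_zero, aP_coeff] at h1
  simp only [Nat.factorial, Nat.succ_pos, if_true, Nat.cast_one, map_one] at h1
  refine h1.congr ?_
  exact (al_asymp (k + 1)).trans (ww_O.pow (k + 1))

lemma Ex_logal {k : ℕ} (h : Ex k al 1) : Ex k (fun n => Real.log (al n)) 0 := by
  have h0 : Ex k (fun n => al n - 1) 0 := by
    have := h.sub (Ex_const k 1)
    simpa using this
  have h1 := h0.comp al_O (logP k) (fun u => Real.log (1 + u)) (log_taylor k)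
  have : (logP k).comp 0 = 0 := by
    rw [Polynomial.comp_zero, logP]; simp [Polynomial.eval_finsetSum]
  rw [this] at h1
  simpa using h1

lemma Ex_inval {k : ℕ} (h : Ex k al 1) : Ex k (fun n => (al n)⁻¹) 1 := by
  have h0 : Ex k (fun n => al n - 1) 0 := by
    have := h.sub (Ex_const k 1)
    simpa using this
  have h1 := h0.comp al_O (invP k) (fun u => (1 + u)⁻¹) (inv_taylor k)
  have : (invP k).comp 0 = 1 := by
    rw [Polynomial.comp_zero, invP, Finset.sum_range_succ']
    simp [Polynomial.eval_finsetSum]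
  rw [this] at h1
  simpa using h1

lemma Ex_logz {k : ℕ} (h : Ex k zz Polynomial.X) :
    Ex k (fun n => Real.log (1 + zz n)) (logP k) := by
  have h1 := h.comp zz_O (logP k) (fun u => Real.log (1 + u)) (log_taylor k)
  rwa [Polynomial.comp_X] at h1

lemma Ex_zz (k : ℕ) : Ex k zz Polynomial.X := by
  induction k with
  | zero =>
    refine (Ex_tt 0).congr ?_
    unfold Cg
    simpa using zz_O.sub (isBigO_refl tt atTop)
  | succ k ih =>
    have h1 := (Ex_logz ih).sub (Ex_logal (Ex_al (Ex_ww ih)))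
    have h2 := (Ex_tt (k + 1)).add h1.ta_mul
    rw [add_zero] at h2
    refine h2.congr' ?_
    filter_upwards [zz_eq] with n hn
    exact hn.symm

/-- `(∑ j!/2^j X^j - (∑ j! X^j)^2)/X` truncated -/
noncomputable def cP (k : ℕ) : Polynomial ℚ := (bP (k + 2) - aP (k + 2) ^ 2).divX

lemma cP_X (k : ℕ) : cP k * Polynomial.X = bP (k + 2) - aP (k + 2) ^ 2 := by
  have := Polynomial.divX_mul_X_add (bP (k + 2) - aP (k + 2) ^ 2)
  have h0 : (bP (k + 2) - aP (k + 2) ^ 2).coeff 0 = 0 := by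
    rw [Polynomial.coeff_sub, sq, Polynomial.mul_coeff_zero, aP_coeff, bP_coeff]
    simp
  rw [h0, map_zero, add_zero] at this
  exact this

lemma cP_zero (k : ℕ) : (cP k).coeff 0 = -3 / 2 := by
  rw [cP, Polynomial.coeff_divX, Polynomial.coeff_sub, sq, Polynomial.mul_coeff_one]
  simp only [aP_coeff, bP_coeff]
  simp
  norm_num

lemma mbe_asymp (k : ℕ) :
    (fun n => mm n * (be n - al n ^ 2) - Polynomial.aeval (ww n) (cP k)) =O[atTop]
      fun n => ww n ^ (k + 1) := by
  have h1 := be_asymp (k + 2)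
  have h2 := al_asymp (k + 2)
  have hal : al =O[atTop] (fun _ => (1 : ℝ)) := tendsto_al.isBigO_one ℝ
  have haP := aeval_bdd (tendsto_ww.isBigO_one ℝ) (aP (k + 2))
  have h3 := h2.mul (hal.add haP)
  simp only [mul_one] at h3
  have h4 := (isBigO_refl mm atTop).mul (h1.sub h3)
  refine h4.congr (fun n => ?_) (fun n => ?_)
  · have hM := mm_pos n
    have e := congrArg (Polynomial.aeval (ww n)) (cP_X k)
    simp only [map_mul, map_sub, map_pow, Polynomial.aeval_X] at e
    have e2 : Polynomial.aeval (ww n) (cP k) =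
        mm n * (Polynomial.aeval (ww n) (cP k) * ww n) := by
      rw [ww]; field_simp
    rw [e2, e]
    ring
  · have hM := mm_pos n
    have : mm n * ww n = 1 := by rw [ww]; field_simp
    rw [pow_succ _ (k + 1), mul_comm (ww n ^ (k + 1)), ← mul_assoc, this, one_mul]

/-- the remainder function -/
noncomputable def RR (n : ℕ) : ℝ :=
  2 * ss n / (n : ℝ) ^ 2 - Real.log n - Real.log (Real.log n)

lemma Ex_RR (k : ℕ) : Ex k RR (logP k + Polynomial.C (-3 / 2)) := by
  have hz := Ex_zz k
  have hw := Ex_ww hz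
  have ha := Ex_al hw
  have h1 := hw.poly (cP k)
  rw [Polynomial.comp_zero, ← Polynomial.coeff_zero_eq_eval_zero, cP_zero] at h1
  have h2 : Ex k (fun n => mm n * (be n - al n ^ 2)) (Polynomial.C (-3 / 2)) := by
    refine h1.congr ?_
    exact (mbe_asymp k).trans (ww_O.pow (k + 1))
  have h3 := ((Ex_logz hz).sub (Ex_logal ha)).add (h2.mul ((Ex_inval ha).pow 2))
  rw [sub_zero, one_pow, mul_one] at h3
  refine h3.congr' ?_
  filter_upwards [main_eq] with n hn
  exact hn.symm

/-- homogeneous part -/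
noncomputable def Ph (s : ℕ) (p : Polynomial (Polynomial ℚ)) : Polynomial ℚ :=
  ∑ i ∈ Finset.range (s + 1), Polynomial.C ((p.coeff (s - i)).coeff i) * Polynomial.X ^ i

lemma Ph_add (s : ℕ) (p q) : Ph s (p + q) = Ph s p + Ph s q := by
  simp [Ph, add_mul, Finset.sum_add_distrib]

lemma Ph_natDegree (s : ℕ) (p) : (Ph s p).natDegree ≤ s := by
  refine Polynomial.natDegree_sum_le_of_forall_le _ _ fun i hi => ?_
  refine (Polynomial.natDegree_C_mul_X_pow_le _ _).trans ?_
  have := Finset.mem_range.mp hi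
  omega

lemma Ph_coeff (s : ℕ) (p) : (Ph s p).coeff s = (p.coeff 0).coeff s := by
  simp [Ph, Polynomial.coeff_X_pow]

lemma Ph_monomial (s i j : ℕ) (a : ℚ) :
    Ph s (Polynomial.monomial j (Polynomial.monomial i a)) =
      if i + j = s then Polynomial.C a * Polynomial.X ^ i else 0 := by
  have : ∀ i' ∈ Finset.range (s + 1),
      Polynomial.C (((Polynomial.monomial j (Polynomial.monomial i a)).coeff (s - i')).coeff i') *
        (Polynomial.X : Polynomial ℚ) ^ i' =
      if i' = i then (if i + j = s then Polynomial.C a * Polynomial.X ^ i else 0) else 0 := by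
    intro i' hi'
    have := Finset.mem_range.mp hi'
    rw [Polynomial.coeff_monomial]
    by_cases h1 : i' = i
    · subst h1
      by_cases h2 : i' + j = s
      · have h3 : j = s - i' := by omega
        rw [if_pos h3, if_pos rfl, if_pos h2, Polynomial.coeff_monomial, if_pos rfl]
      · have h3 : j ≠ s - i' := by omega
        simp [h2, h3]
    · by_cases h3 : j = s - i'
      · rw [if_pos h3, Polynomial.coeff_monomial, if_neg (fun h => h1 h.symm), if_neg h1]
        simp
      · rw [if_neg h3, if_neg h1]; simp
  rw [Ph, Finset.sum_congr rfl this, Finset.sum_ite_eq']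
  by_cases h : i + j = s
  · rw [if_pos (Finset.mem_range.mpr (by omega))]
  · simp [h]

lemma Cg_ev (m : ℕ) (p : Polynomial (Polynomial ℚ)) :
    Cg m (fun n => ev n p)
      (fun n => ∑ s ∈ Finset.range (m + 1),
        Polynomial.aeval (Real.log (Real.log n)) (Ph s p) * ta n ^ s) := by
  induction p using Polynomial.induction_on' with
  | add p q hp hq =>
    simpa [Ph_add, add_mul, Finset.sum_add_distrib] using hp.add hq
  | monomial j b =>
    induction b using Polynomial.induction_on' with
    | add b c hb hc =>
      simpa [Ph_add, add_mul, Finset.sum_add_distrib] using hb.add hc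
    | monomial i a =>
      have e1 : ∀ n, ev n (Polynomial.monomial j (Polynomial.monomial i a)) =
          (a : ℝ) * tt n ^ i * ta n ^ j := by
        intro n
        rw [← Polynomial.C_mul_X_pow_eq_monomial, map_mul, map_pow, ev_C, ev_X,
          Polynomial.aeval_monomial]
        simp
      simp only [e1, Ph_monomial]
      by_cases h : i + j ≤ m
      · have : ∀ n : ℕ, (∑ s ∈ Finset.range (m + 1), Polynomial.aeval (Real.log (Real.log n))
            (if i + j = s then Polynomial.C a * Polynomial.X ^ i else 0) * ta n ^ s) =
            (a : ℝ) * tt n ^ i * ta n ^ j := by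
          intro n
          rw [Finset.sum_eq_single (i + j)]
          · simp [tt, ta]
            ring
          · intro s _ hs
            rw [if_neg (fun h => hs h.symm)]; simp
          · intro hh
            exact absurd (Finset.mem_range.mpr (by omega)) hh
        simp only [this]
        exact Cg.refl _ _
      · have : ∀ n : ℕ, (∑ s ∈ Finset.range (m + 1), Polynomial.aeval (Real.log (Real.log n))
            (if i + j = s then Polynomial.C a * Polynomial.X ^ i else 0) * ta n ^ s) = 0 := by
          intro n
          refine Finset.sum_eq_zero fun s hs => ?_
          have := Finset.mem_range.mp hs
          rw [if_neg (by omega)]; simp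
        simp only [this]
        unfold Cg
        simp only [sub_zero]
        have h1 := ((isBigO_refl (fun n => tt n ^ i) atTop).mul (ta_O_tt.pow j)).const_mul_left (a : ℝ)
        refine (h1.trans ?_).congr_left fun n => by ring
        refine IsBigO.trans ?_ (tt_pow_mono (show m + 1 ≤ i + j by omega))
        simp only [pow_add]
        exact isBigO_refl _ _

lemma aeval_ll_ta (q : Polynomial ℚ) (j : ℕ) (hj : 1 ≤ j) :
    Tendsto (fun n : ℕ => Polynomial.aeval (Real.log (Real.log n)) q * ta n ^ j) atTop (𝓝 0) := by
  have key : ∀ i : ℕ, Tendsto (fun n : ℕ => Real.log (Real.log n) ^ i * ta n) atTop (𝓝 0) := by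
    intro i
    have : Tendsto (fun x : ℝ => Real.log x ^ i / x) atTop (𝓝 0) :=
      (Real.isLittleO_pow_log_id_atTop (n := i)).tendsto_div_nhds_zero
    refine (this.comp tendsto_lg).congr fun n => ?_
    simp [ta, div_eq_mul_inv]
  obtain ⟨c, rfl⟩ := Nat.exists_eq_add_of_le hj
  have h1 : Tendsto (fun n : ℕ => Polynomial.aeval (Real.log (Real.log n)) q * ta n) atTop (𝓝 0) := by
    induction q using Polynomial.induction_on' with
    | add p q hp hq => simpa [add_mul] using hp.add hq
    | monomial i a =>
      simpa [Polynomial.aeval_monomial, mul_assoc] using (key i).const_mul (a : ℝ)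
  have h2 : (fun n => ta n ^ c) =O[atTop] (fun _ => (1 : ℝ)) := by simpa using ta_O_one.pow c
  have h3 := (isBigO_refl (fun n : ℕ =>
    Polynomial.aeval (Real.log (Real.log n)) q * ta n) atTop).mul h2
  simp only [mul_one] at h3
  refine (h3.trans_tendsto h1).congr fun n => ?_
  ring

lemma poly_zero_of_tendsto (q : Polynomial ℚ)
    (h : Tendsto (fun n : ℕ => Polynomial.aeval (Real.log (Real.log n)) q) atTop (𝓝 0)) : q = 0 := by
  have e : ∀ x : ℝ, Polynomial.aeval x q = (q.map (algebraMap ℚ ℝ)).eval x := by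
    intro x; rw [Polynomial.aeval_def, Polynomial.eval_map]
  simp only [e] at h
  set Q := q.map (algebraMap ℚ ℝ) with hQ
  have hQ0 : Q = 0 := by
    by_cases hd : 0 < Q.degree
    · exfalso
      have h1 := (Polynomial.abs_tendsto_atTop Q hd).comp tendsto_ll
      have h2 := h.abs
      exact not_tendsto_atTop_of_tendsto_nhds h2 h1
    · have hc := Polynomial.eq_C_of_degree_le_zero (not_lt.mp hd)
      rw [hc] at h ⊢
      simp only [Polynomial.eval_C] at h
      rw [tendsto_nhds_unique tendsto_const_nhds h, map_zero]
  exact (Polynomial.map_eq_zero_iff (algebraMap ℚ ℝ).injective).mp hQ0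

lemma uniq (m : ℕ) (d : ℕ → Polynomial ℚ)
    (h : (fun n : ℕ => ∑ s ∈ Finset.Icc 1 m,
      Polynomial.aeval (Real.log (Real.log n)) (d s) * ta n ^ s) =O[atTop]
      fun n => tt n ^ (m + 1)) : ∀ s ∈ Finset.Icc 1 m, d s = 0 := by
  intro s
  induction s using Nat.strong_induction_on with
  | _ s ih =>
  intro hs
  apply poly_zero_of_tendsto
  have hs' := Finset.mem_Icc.mp hs
  have h1 := (isBigO_refl (fun n : ℕ => Real.log n ^ s) atTop).mul h
  have h2 : Tendsto (fun n : ℕ => Real.log n ^ s * tt n ^ (m + 1)) atTop (𝓝 0) := by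
    refine (aeval_ll_ta (Polynomial.X ^ (m + 1)) (m + 1 - s) (by omega)).congr' ?_
    filter_upwards [tendsto_lg.eventually_ge_atTop 1] with n hn
    have hL : 0 < Real.log (n : ℝ) := by linarith
    have e : m + 1 = s + (m + 1 - s) := by omega
    have e2 : Real.log (n : ℝ) ^ s * ta n ^ (m + 1) = ta n ^ (m + 1 - s) := by
      conv_lhs => rw [e, pow_add, ← mul_assoc, ← mul_pow]
      rw [show Real.log (n : ℝ) * ta n = 1 by rw [ta]; field_simp]; simp
    have e3 : tt n = Real.log (Real.log n) * ta n := by rw [tt, ta]; ring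
    rw [e3, mul_pow, mul_left_comm, e2]; simp
  have h3 := h1.trans_tendsto h2
  have h4 : Tendsto (fun n : ℕ => ∑ r ∈ (Finset.Icc 1 m).erase s,
      Real.log n ^ s * (Polynomial.aeval (Real.log (Real.log n)) (d r) * ta n ^ r)) atTop (𝓝 0) := by
    rw [← Finset.sum_const_zero (s := (Finset.Icc 1 m).erase s) (M := ℝ)]
    refine tendsto_finsetSum _ fun r hr => ?_
    obtain ⟨hr1, hr2⟩ := Finset.mem_erase.mp hr
    rcases lt_or_gt_of_ne hr1 with h | h
    · rw [ih r h hr2]; simp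
    · refine (aeval_ll_ta (d r) (r - s) (by omega)).congr' ?_
      filter_upwards [tendsto_lg.eventually_ge_atTop 1] with n hn
      have hL : 0 < Real.log (n : ℝ) := by linarith
      have e : r = s + (r - s) := by omega
      have e2 : Real.log (n : ℝ) ^ s * ta n ^ r = ta n ^ (r - s) := by
        conv_lhs => rw [e, pow_add, ← mul_assoc, ← mul_pow]
        rw [show Real.log (n : ℝ) * ta n = 1 by rw [ta]; field_simp]; simp
      rw [mul_left_comm, e2]
  have h5 := h3.sub h4
  rw [sub_zero] at h5
  refine h5.congr' ?_
  filter_upwards [tendsto_lg.eventually_ge_atTop 1] with n hn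
  have hL : 0 < Real.log (n : ℝ) := by linarith
  rw [Finset.mul_sum, ← Finset.add_sum_erase _ _ hs, add_sub_cancel_right, mul_left_comm, ← mul_pow,
    show Real.log (n : ℝ) * ta n = 1 by rw [ta]; field_simp]
  simp

end PNT

end PartPB4

section PartPB5

open Set MeasureTheory Filter Topology Asymptotics

namespace PNT

lemma bddc (f : ℝ → ℝ → ℝ) (hf : Continuous fun p : ℝ × ℝ => f p.1 p.2) :
    (fun n => f (tt n) (ta n)) =O[atTop] (fun _ => (1 : ℝ)) := by
  have h := (hf.tendsto (0, 0)).comp (tendsto_tt.prodMk_nhds tendsto_ta)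
  exact h.isBigO_one ℝ

lemma Cg_trunc (f g F : ℝ → ℝ → ℝ) (hF : Continuous fun p : ℝ × ℝ => F p.1 p.2)
    (h : ∀ T r, f T (T * r) - g T (T * r) = T ^ 3 * F T r) :
    Cg 2 (fun n => f (tt n) (ta n)) (fun n => g (tt n) (ta n)) := by
  have hr : Tendsto (fun n : ℕ => (Real.log (Real.log n))⁻¹) atTop (𝓝 0) :=
    tendsto_ll.inv_tendsto_atTop
  have h1 : (fun n : ℕ => F (tt n) (Real.log (Real.log n))⁻¹) =O[atTop] (fun _ => (1 : ℝ)) :=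
    ((hF.tendsto (0, 0)).comp (tendsto_tt.prodMk_nhds hr)).isBigO_one ℝ
  have h2 := (isBigO_refl (fun n => tt n ^ 3) atTop).mul h1
  simp only [mul_one] at h2
  refine h2.congr' ?_ EventuallyEq.rfl
  filter_upwards [tendsto_ll.eventually_ge_atTop 1] with n hn
  have e : ta n = tt n * (Real.log (Real.log n))⁻¹ := by
    have : Real.log (Real.log n) ≠ 0 := by linarith
    rw [ta, tt]; field_simp
  rw [← h, ← e]

lemma taylor_Cg {k : ℕ} (φ ψ : ℝ → ℝ) {f : ℕ → ℝ} (hf : f =O[atTop] tt)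
    (h : (fun u => φ u - ψ u) =O[𝓝 0] fun u : ℝ => u ^ (k + 1)) :
    Cg k (fun n => φ (f n)) (fun n => ψ (f n)) := by
  have ht : Tendsto f atTop (𝓝 0) := hf.trans_tendsto tendsto_tt
  exact (h.comp_tendsto ht).trans (hf.pow (k + 1))

lemma log1 : (fun u => Real.log (1 + u) - u) =O[𝓝 0] fun u : ℝ => u ^ (1 + 1) := by
  simpa [logP] using log_taylor 1

lemma log2 : (fun u => Real.log (1 + u) - (u - u ^ 2 / 2)) =O[𝓝 0] fun u : ℝ => u ^ (2 + 1) := by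
  refine (log_taylor 2).congr_left fun u => ?_
  simp [logP, Finset.sum_range_succ]
  ring

lemma inv0 : (fun u => (1 + u)⁻¹ - 1) =O[𝓝 0] fun u : ℝ => u ^ (0 + 1) := by
  simpa [invP] using inv_taylor 0

lemma inv1 : (fun u => (1 + u)⁻¹ - (1 - u)) =O[𝓝 0] fun u : ℝ => u ^ (1 + 1) := by
  refine (inv_taylor 1).congr_left fun u => ?_
  simp [invP, Finset.sum_range_succ]
  ring

lemma inv2 : (fun u => (1 + u)⁻¹ - (1 - u + u ^ 2)) =O[𝓝 0] fun u : ℝ => u ^ (2 + 1) := by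
  refine (inv_taylor 2).congr_left fun u => ?_
  simp [invP, Finset.sum_range_succ]
  ring

lemma logz_O : (fun n => Real.log (1 + zz n)) =O[atTop] tt := by
  have h1 : (fun u => Real.log (1 + u)) =O[𝓝 0] fun u : ℝ => u := by
    simpa [logP] using log_taylor 0
  exact (h1.comp_tendsto tendsto_zz).trans zz_O

lemma logal_O : (fun n => Real.log (al n)) =O[atTop] tt := by
  have h1 : (fun u => Real.log (1 + u)) =O[𝓝 0] fun u : ℝ => u := by
    simpa [logP] using log_taylor 0
  have := (h1.comp_tendsto (al_O.trans_tendsto tendsto_tt)).trans al_O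
  simpa [Function.comp_def] using this

lemma zz1 : Cg 1 zz tt := by
  have h := ta_O_tt.mul (logz_O.sub logal_O)
  refine h.congr' ?_ ?_
  · filter_upwards [zz_eq] with n hn
    linarith
  · filter_upwards with n
    ring

lemma ww1 : Cg 1 ww ta := by
  have h := (taylor_Cg _ _ zz_O inv0).ta_mul
  have h2 := h.congr' (f' := ww) (by
    filter_upwards [ww_eq] with n hn
    exact hn.symm)
  simpa using h2

lemma ww2 : Cg 2 ww (fun n => ta n * (1 - tt n)) := by
  have h := (taylor_Cg _ _ zz_O inv1).trans ((Cg.refl 1 (fun _ => (1 : ℝ))).sub zz1)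
  refine h.ta_mul.congr' ?_
  filter_upwards [ww_eq] with n hn
  exact hn.symm

lemma al1 : Cg 1 (fun n => al n - 1) ta := by
  refine Cg.trans ?_ ww1
  have := (al_asymp 2).trans (ww_O.pow 2)
  refine this.congr_left fun n => ?_
  simp [aP, Finset.sum_range_succ]
  ring

lemma al2 : Cg 2 (fun n => al n - 1) (fun n => ta n - ta n * tt n + 2 * ta n ^ 2) := by
  have h1 : Cg 2 (fun n => al n - 1) (fun n => ww n + 2 * (ww n * ww n)) := by
    have := (al_asymp 3).trans (ww_O.pow 3)
    refine this.congr_left fun n => ?_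
    simp [aP, Finset.sum_range_succ, Nat.factorial, map_ofNat]
    ring
  have hb := bddc (fun T t => t * (1 - T)) (by fun_prop)
  have h2 := ww2.add ((Cg.refl 2 (fun _ => (2 : ℝ))).mul (ww2.mul ww2 hb hb)
    (isBigO_refl _ _ |>.trans (isBigO_const_const _ one_ne_zero _))
    (by simpa using hb.mul hb))
  refine (h1.trans h2).trans ?_
  refine Cg_trunc (fun T t => t * (1 - T) + 2 * (t * (1 - T) * (t * (1 - T))))
    (fun T t => t - t * T + 2 * t ^ 2)
    (fun T r => (-4) * T ^ 0 * r ^ 2 + (2) * T ^ 1 * r ^ 2) (by fun_prop) ?_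
  intro T r
  ring

lemma logal1 : Cg 1 (fun n => Real.log (al n)) ta := by
  have := (taylor_Cg _ _ al_O log1).trans al1
  simpa using this

lemma logz1 : Cg 1 (fun n => Real.log (1 + zz n)) tt := (taylor_Cg _ _ zz_O log1).trans zz1

lemma zz2 : Cg 2 zz (fun n => tt n + ta n * (tt n - ta n)) := by
  have h := (Cg.refl 2 tt).add (logz1.sub logal1).ta_mul
  refine h.congr' ?_
  filter_upwards [zz_eq] with n hn
  exact hn.symm

lemma logz2 : Cg 2 (fun n => Real.log (1 + zz n))
    (fun n => tt n + ta n * tt n - ta n ^ 2 - tt n ^ 2 / 2) := by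
  have hb := bddc (fun T t => T + t * (T - t)) (by fun_prop)
  have h := zz2.sub ((Cg.refl 2 (fun _ => (1 / 2 : ℝ))).mul (zz2.mul zz2 hb hb)
    (isBigO_refl _ _ |>.trans (isBigO_const_const _ one_ne_zero _))
    (by simpa using hb.mul hb))
  have h1 := taylor_Cg _ _ zz_O log2
  refine (h1.trans (h.congr' ?_)).trans ?_
  · filter_upwards with n
    ring
  refine Cg_trunc
    (fun T t => (T + t * (T - t)) - 1 / 2 * ((T + t * (T - t)) * (T + t * (T - t))))
    (fun T t => T + t * T - t ^ 2 - T ^ 2 / 2)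
    (fun T r => (-1) * T ^ 0 * r ^ 1 + (1) * T ^ 0 * r ^ 2 + (-1/2) * T ^ 1 * r ^ 2 +
      (1) * T ^ 1 * r ^ 3 + (-1/2) * T ^ 1 * r ^ 4) (by fun_prop) ?_
  intro T r
  ring

lemma logal2 : Cg 2 (fun n => Real.log (al n))
    (fun n => ta n - ta n * tt n + 3 / 2 * ta n ^ 2) := by
  have hb := bddc (fun T t => t - t * T + 2 * t ^ 2) (by fun_prop)
  have h := al2.sub ((Cg.refl 2 (fun _ => (1 / 2 : ℝ))).mul (al2.mul al2 hb hb)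
    (isBigO_refl _ _ |>.trans (isBigO_const_const _ one_ne_zero _))
    (by simpa using hb.mul hb))
  have h1 := taylor_Cg _ _ al_O log2
  simp only [add_sub_cancel] at h1
  refine (h1.trans (h.congr' ?_)).trans ?_
  · filter_upwards with n
    ring
  refine Cg_trunc
    (fun T t => (t - t * T + 2 * t ^ 2) -
      1 / 2 * ((t - t * T + 2 * t ^ 2) * (t - t * T + 2 * t ^ 2)))
    (fun T t => t - t * T + 3 / 2 * t ^ 2)
    (fun T r => (1) * T ^ 0 * r ^ 2 + (-2) * T ^ 0 * r ^ 3 + (-1/2) * T ^ 1 * r ^ 2 +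
      (2) * T ^ 1 * r ^ 3 + (-2) * T ^ 1 * r ^ 4) (by fun_prop) ?_
  intro T r
  ring

lemma inval2 : Cg 2 (fun n => (al n)⁻¹)
    (fun n => 1 - ta n + ta n * tt n - ta n ^ 2) := by
  have hb := bddc (fun T t => t - t * T + 2 * t ^ 2) (by fun_prop)
  have h := ((Cg.refl 2 (fun _ => (1 : ℝ))).sub al2).add (al2.mul al2 hb hb)
  have h1 := taylor_Cg _ _ al_O inv2
  simp only [add_sub_cancel] at h1
  refine (h1.trans (h.congr' ?_)).trans ?_
  · filter_upwards with n
    ring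
  refine Cg_trunc
    (fun T t => 1 - (t - t * T + 2 * t ^ 2) +
      ((t - t * T + 2 * t ^ 2) * (t - t * T + 2 * t ^ 2)))
    (fun T t => 1 - t + t * T - t ^ 2)
    (fun T r => (-2) * T ^ 0 * r ^ 2 + (4) * T ^ 0 * r ^ 3 + (1) * T ^ 1 * r ^ 2 +
      (-4) * T ^ 1 * r ^ 3 + (4) * T ^ 1 * r ^ 4) (by fun_prop) ?_
  intro T r
  ring

lemma invsq2 : Cg 2 (fun n => (al n)⁻¹ ^ 2)
    (fun n => 1 - 2 * ta n + 2 * ta n * tt n - ta n ^ 2) := by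
  have hb := bddc (fun T t => 1 - t + t * T - t ^ 2) (by fun_prop)
  have h := inval2.mul inval2 hb hb
  refine (h.congr' ?_).trans ?_
  · filter_upwards with n
    ring
  refine Cg_trunc
    (fun T t => (1 - t + t * T - t ^ 2) * (1 - t + t * T - t ^ 2))
    (fun T t => 1 - 2 * t + 2 * t * T - t ^ 2)
    (fun T r => (-2) * T ^ 0 * r ^ 2 + (2) * T ^ 0 * r ^ 3 + (1) * T ^ 1 * r ^ 2 +
      (-2) * T ^ 1 * r ^ 3 + (1) * T ^ 1 * r ^ 4) (by fun_prop) ?_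
  intro T r
  ring

lemma cP2_eq {w : ℝ} (hw : w ≠ 0) : Polynomial.aeval w (cP 2) =
    -3 / 2 - 9 / 2 * w - 61 / 4 * w ^ 2 + w ^ 3 * (-16 - 24 * w - 36 * w ^ 2) := by
  have e := congrArg (Polynomial.aeval w) (cP_X 2)
  simp only [map_mul, map_sub, map_pow, Polynomial.aeval_X] at e
  have e1 : Polynomial.aeval w (bP (2 + 2)) = 1 + w / 2 + w ^ 2 / 2 + 3 / 4 * w ^ 3 := by
    simp [bP, Finset.sum_range_succ, Nat.factorial, map_ofNat]
    ring
  have e2 : Polynomial.aeval w (aP (2 + 2)) = 1 + w + 2 * w ^ 2 + 6 * w ^ 3 := by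
    simp [aP, Finset.sum_range_succ, Nat.factorial, map_ofNat]
  rw [e1, e2] at e
  apply mul_right_cancel₀ hw
  rw [e]
  ring

lemma mbe2 : Cg 2 (fun n => mm n * (be n - al n ^ 2))
    (fun n => -3 / 2 - 9 / 2 * (ta n - ta n * tt n) - 61 / 4 * ta n ^ 2) := by
  have h1 : Cg 2 (fun n => mm n * (be n - al n ^ 2)) (fun n => Polynomial.aeval (ww n) (cP 2)) :=
    (mbe_asymp 2).trans (ww_O.pow 3)
  have h2 : Cg 2 (fun n => Polynomial.aeval (ww n) (cP 2))
      (fun n => -3 / 2 - 9 / 2 * ww n - 61 / 4 * (ww n * ww n)) := by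
    have hb : (fun n => -16 - 24 * ww n - 36 * ww n ^ 2) =O[atTop] (fun _ => (1 : ℝ)) := by
      have hc : Continuous (fun w : ℝ => -16 - 24 * w - 36 * w ^ 2) := by fun_prop
      exact ((hc.tendsto 0).comp tendsto_ww).isBigO_one ℝ
    have := (ww_O.pow 3).mul hb
    simp only [mul_one] at this
    refine this.congr_left fun n => ?_
    have hw : ww n ≠ 0 := by
      have := mm_pos n
      rw [ww]; positivity
    beta_reduce
    rw [cP2_eq hw]
    ring
  have hb := bddc (fun T t => t * (1 - T)) (by fun_prop)
  have h3 := ((Cg.refl 2 (fun _ => (-3 / 2 : ℝ))).sub ((Cg.refl 2 (fun _ => (9 / 2 : ℝ))).mul ww2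
    (isBigO_refl _ _ |>.trans (isBigO_const_const _ one_ne_zero _)) hb)).sub
    ((Cg.refl 2 (fun _ => (61 / 4 : ℝ))).mul (ww2.mul ww2 hb hb)
    (isBigO_refl _ _ |>.trans (isBigO_const_const _ one_ne_zero _))
    (by simpa using hb.mul hb))
  refine (h1.trans (h2.trans h3)).trans ?_
  refine Cg_trunc
    (fun T t => -3 / 2 - 9 / 2 * (t * (1 - T)) - 61 / 4 * (t * (1 - T) * (t * (1 - T))))
    (fun T t => -3 / 2 - 9 / 2 * (t - t * T) - 61 / 4 * t ^ 2)
    (fun T r => (61/2) * T ^ 0 * r ^ 2 + (-61/4) * T ^ 1 * r ^ 2) (by fun_prop) ?_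
  intro T r
  ring

lemma RR2 : Cg 2 RR (fun n => -3 / 2 + (tt n - 5 / 2 * ta n) +
    (-1 / 2 * tt n ^ 2 + 7 / 2 * ta n * tt n - 29 / 4 * ta n ^ 2)) := by
  have hb1 := bddc (fun T t => -3 / 2 - 9 / 2 * (t - t * T) - 61 / 4 * t ^ 2) (by fun_prop)
  have hb2 := bddc (fun T t => 1 - 2 * t + 2 * t * T - t ^ 2) (by fun_prop)
  have h := (logz2.sub logal2).add (mbe2.mul invsq2 hb1 hb2)
  refine (h.congr' (f' := RR) ?_).trans ?_
  · filter_upwards [main_eq] with n hn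
    exact hn.symm
  refine Cg_trunc
    (fun T t => (T + t * T - t ^ 2 - T ^ 2 / 2) - (t - t * T + 3 / 2 * t ^ 2) +
      (-3 / 2 - 9 / 2 * (t - t * T) - 61 / 4 * t ^ 2) * (1 - 2 * t + 2 * t * T - t ^ 2))
    (fun T t => -3 / 2 + (T - 5 / 2 * t) + (-1 / 2 * T ^ 2 + 7 / 2 * t * T - 29 / 4 * t ^ 2))
    (fun T r => (-18) * T ^ 0 * r ^ 2 + (35) * T ^ 0 * r ^ 3 + (9) * T ^ 1 * r ^ 2 +
      (-35) * T ^ 1 * r ^ 3 + (61/4) * T ^ 1 * r ^ 4) (by fun_prop) ?_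
  intro T r
  ring

end PNT

end PartPB5

section Final
open Filter Asymptotics Topology

namespace PNT

lemma fam_id (m : ℕ) (T : ℕ → Polynomial ℚ) (n : ℕ) (hn : 1 ≤ n) :
    sumPrimes n -
        (n : ℝ) ^ 2 / 2 * (Real.log n + Real.log (Real.log n) - 3 / 2 +
          ∑ s ∈ Finset.Icc 1 m, (-1 : ℝ) ^ (s + 1) *
            (Polynomial.aeval (Real.log (Real.log n)) (T s)) /
              ((s : ℝ) * Real.log n ^ s)) =
    (n : ℝ) ^ 2 / 2 * (RR n - (-3 / 2 + ∑ s ∈ Finset.Icc 1 m,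
      Polynomial.aeval (Real.log (Real.log n)) (Polynomial.C ((-1 : ℚ) ^ (s + 1) / s) * T s) *
        ta n ^ s)) := by
  have hs : sumPrimes n = ss n := rfl
  have hn' : (n : ℝ) ≠ 0 := by positivity
  have e : ∑ s ∈ Finset.Icc 1 m,
      Polynomial.aeval (Real.log (Real.log n)) (Polynomial.C ((-1 : ℚ) ^ (s + 1) / s) * T s) *
        ta n ^ s = ∑ s ∈ Finset.Icc 1 m, (-1 : ℝ) ^ (s + 1) *
            (Polynomial.aeval (Real.log (Real.log n)) (T s)) /
              ((s : ℝ) * Real.log n ^ s) := by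
    refine Finset.sum_congr rfl fun s _ => ?_
    rw [map_mul, Polynomial.aeval_C, ta, div_pow, one_pow]
    simp only [eq_ratCast]
    push_cast
    rw [div_mul_eq_mul_div, div_mul_div_comm, mul_one]
  rw [e, hs, RR]
  field_simp
  ring

lemma fam_iff (m : ℕ) (T : ℕ → Polynomial ℚ) :
    (∃ C : ℝ, 0 < C ∧ ∃ N : ℕ, ∀ n : ℕ, N ≤ n →
    |sumPrimes n -
        (n : ℝ) ^ 2 / 2 * (Real.log n + Real.log (Real.log n) - 3 / 2 +
          ∑ s ∈ Finset.Icc 1 m, (-1 : ℝ) ^ (s + 1) *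
            (Polynomial.aeval (Real.log (Real.log n)) (T s)) /
              ((s : ℝ) * Real.log n ^ s))| ≤
      C * (n : ℝ) ^ 2 * Real.log (Real.log n) ^ (m + 1) / Real.log n ^ (m + 1)) ↔
    Cg m RR (fun n => -3 / 2 + ∑ s ∈ Finset.Icc 1 m,
      Polynomial.aeval (Real.log (Real.log n)) (Polynomial.C ((-1 : ℚ) ^ (s + 1) / s) * T s) *
        ta n ^ s) := by
  constructor
  · rintro ⟨C, hC, N, h⟩
    refine IsBigO.of_bound (2 * C) ?_
    filter_upwards [eventually_ge_atTop N, eventually_ge_atTop 1] with n hN hn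
    have h1 := h n hN
    have hn' : (0 : ℝ) < (n : ℝ) ^ 2 := by positivity
    rw [fam_id m T n hn, abs_mul, abs_of_pos (by positivity)] at h1
    have e : C * (n : ℝ) ^ 2 * Real.log (Real.log n) ^ (m + 1) / Real.log n ^ (m + 1) =
        (n : ℝ) ^ 2 / 2 * (2 * C * tt n ^ (m + 1)) := by
      rw [tt, div_pow]; ring
    rw [e] at h1
    have h2 := le_of_mul_le_mul_left h1 (by positivity)
    rw [Real.norm_eq_abs]
    refine h2.trans ?_
    gcongr
    exact Real.le_norm_self _
  · intro h
    obtain ⟨c, hc, h1⟩ := IsBigO.exists_pos h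
    have h2 := h1.bound
    have h3 : ∀ᶠ n : ℕ in atTop, 0 ≤ tt n := by
      filter_upwards [tendsto_lg.eventually_ge_atTop 1, tendsto_ll.eventually_ge_atTop 1]
        with n a b
      rw [tt]
      exact div_nonneg (by linarith) (by linarith)
    obtain ⟨N, hN⟩ := eventually_atTop.mp (h2.and (h3.and (eventually_ge_atTop 1)))
    refine ⟨c / 2, by positivity, N, fun n hn => ?_⟩
    obtain ⟨a, b, d⟩ := hN n hn
    have hn' : (0 : ℝ) < (n : ℝ) ^ 2 := by positivity
    rw [fam_id m T n d, abs_mul, abs_of_pos (by positivity)]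
    have e : c / 2 * (n : ℝ) ^ 2 * Real.log (Real.log n) ^ (m + 1) / Real.log n ^ (m + 1) =
        (n : ℝ) ^ 2 / 2 * (c * tt n ^ (m + 1)) := by
      rw [tt, div_pow]; ring
    rw [e]
    rw [Real.norm_eq_abs, Real.norm_of_nonneg (by positivity)] at a
    gcongr

lemma logP_coeff_zero (k : ℕ) : (logP k).coeff 0 = 0 := by
  rw [Polynomial.coeff_zero_eq_eval_zero, logP]; simp [Polynomial.eval_finsetSum]

lemma logP_coeff_succ (k i : ℕ) (h : i < k) : (logP k).coeff (i + 1) = (-1) ^ i / (i + 1) := by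
  simp [logP, Polynomial.coeff_X_pow, h]

lemma Icc_split (m : ℕ) (f : ℕ → ℝ) :
    ∑ s ∈ Finset.range (m + 1), f s = f 0 + ∑ s ∈ Finset.Icc 1 m, f s := by
  rw [Finset.sum_range_succ', add_comm]
  congr 1
  have : Finset.Icc 1 m = Finset.Ico 1 (m + 1) := by
    ext i; simp only [Finset.mem_Icc, Finset.mem_Ico]; omega
  rw [this, Finset.sum_Ico_eq_sum_range]
  refine Finset.sum_congr (by simp) fun i _ => by rw [add_comm]

lemma uniq_Cg (m : ℕ) (a b : ℕ → Polynomial ℚ)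
    (ha : Cg m RR (fun n => -3 / 2 + ∑ s ∈ Finset.Icc 1 m,
      Polynomial.aeval (Real.log (Real.log n)) (a s) * ta n ^ s))
    (hb : Cg m RR (fun n => -3 / 2 + ∑ s ∈ Finset.Icc 1 m,
      Polynomial.aeval (Real.log (Real.log n)) (b s) * ta n ^ s)) :
    ∀ s ∈ Finset.Icc 1 m, a s = b s := by
  intro s hs
  have h := uniq m (fun s => a s - b s) (by
    refine IsBigO.congr_left (ha.symm.trans hb) fun n => ?_
    simp only [map_sub, sub_mul, Finset.sum_sub_distrib]
    ring) s hs
  exact sub_eq_zero.mp h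

end PNT

end Final

open PNT

/-- For every `m ≥ 1` there exist unique monic polynomials `T_1, …, T_m ∈ ℚ[X]` with
`deg T_s = s` realizing the asymptotic expansion of the sum of the first `n` primes; moreover
`T_1(x) = x − 5/2` and `T_2(x) = x² − 7x + 29/2`. -/
theorem sumPrimes_asymptotic (m : ℕ) (hm : 1 ≤ m) :
    ∃ T : ℕ → Polynomial ℚ, IsSumPrimesFamily m T ∧
      (∀ T' : ℕ → Polynomial ℚ, IsSumPrimesFamily m T' →
        ∀ s ∈ Finset.Icc 1 m, T' s = T s) ∧
      T 1 = X - C (5 / 2) ∧ (2 ≤ m → T 2 = X ^ 2 - C 7 * X + C (29 / 2)) := by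
  obtain ⟨p, hp, h⟩ := Ex_RR m
  have hP0 : Ph 0 p = Polynomial.C (-3 / 2) := by
    simp [Ph, hp, logP_coeff_zero]
  have hexp : ∀ r, r ≤ m → Cg r RR (fun n => -3 / 2 + ∑ s ∈ Finset.Icc 1 r,
      Polynomial.aeval (Real.log (Real.log n)) (Ph s p) * ta n ^ s) := by
    intro r hr
    have h1 := (h.mono hr).trans (Cg_ev r p)
    simp only [Icc_split, hP0, Polynomial.aeval_C, pow_zero, mul_one] at h1
    simpa using h1
  have hcan : ∀ s : ℕ, 1 ≤ s → ∀ q : Polynomial ℚ,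
      Polynomial.C ((-1 : ℚ) ^ (s + 1) / s) * (Polynomial.C ((-1 : ℚ) ^ (s + 1) * s) * q) = q := by
    intro s hs q
    have hs' : (s : ℚ) ≠ 0 := by positivity
    rw [← mul_assoc, ← Polynomial.C_mul]
    have : (-1 : ℚ) ^ (s + 1) / s * ((-1 : ℚ) ^ (s + 1) * s) = 1 := by
      field_simp
      rw [← pow_mul, mul_comm, pow_mul]; simp
    rw [this]; simp
  have hcan2 : ∀ s : ℕ, 1 ≤ s → ∀ q : Polynomial ℚ,
      Polynomial.C ((-1 : ℚ) ^ (s + 1) * s) * (Polynomial.C ((-1 : ℚ) ^ (s + 1) / s) * q) = q := by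
    intro s hs q
    rw [mul_left_comm]
    exact hcan s hs q
  have hfam : Cg m RR (fun n => -3 / 2 + ∑ s ∈ Finset.Icc 1 m,
      Polynomial.aeval (Real.log (Real.log n)) (Polynomial.C ((-1 : ℚ) ^ (s + 1) / s) *
        (Polynomial.C ((-1 : ℚ) ^ (s + 1) * s) * Ph s p)) * ta n ^ s) := by
    have e : ∀ n : ℕ, ∑ s ∈ Finset.Icc 1 m,
        Polynomial.aeval (Real.log (Real.log n)) (Polynomial.C ((-1 : ℚ) ^ (s + 1) / s) *
          (Polynomial.C ((-1 : ℚ) ^ (s + 1) * s) * Ph s p)) * ta n ^ s =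
        ∑ s ∈ Finset.Icc 1 m,
          Polynomial.aeval (Real.log (Real.log n)) (Ph s p) * ta n ^ s := fun n =>
      Finset.sum_congr rfl fun s hs => by rw [hcan s (Finset.mem_Icc.mp hs).1]
    simp only [e]
    exact hexp m le_rfl
  refine ⟨fun s => Polynomial.C ((-1 : ℚ) ^ (s + 1) * s) * Ph s p, ⟨?_, ?_⟩, ?_, ?_, ?_⟩
  · intro s hs
    have hs' := Finset.mem_Icc.mp hs
    have hdeg : (Polynomial.C ((-1 : ℚ) ^ (s + 1) * s) * Ph s p).natDegree ≤ s :=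
      (Polynomial.natDegree_C_mul_le _ _).trans (Ph_natDegree s p)
    have hco : (Polynomial.C ((-1 : ℚ) ^ (s + 1) * s) * Ph s p).coeff s = 1 := by
      obtain ⟨i, rfl⟩ : ∃ i, s = i + 1 := ⟨s - 1, by omega⟩
      rw [Polynomial.coeff_C_mul, Ph_coeff, hp, Polynomial.coeff_add,
        logP_coeff_succ m i (by omega), Polynomial.coeff_C_succ, add_zero]
      push_cast
      have : (i : ℚ) + 1 ≠ 0 := by positivity
      field_simp
      rw [← pow_add, show i + 1 + 1 + i = 2 * (i + 1) by ring, pow_mul]; simp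
    exact ⟨Polynomial.monic_of_natDegree_le_of_coeff_eq_one s hdeg hco,
      Polynomial.natDegree_eq_of_le_of_coeff_ne_zero hdeg (by rw [hco]; exact one_ne_zero)⟩
  · exact (fam_iff m _).mpr hfam
  · intro T' hT' s hs
    have h1 := (fam_iff m T').mp hT'.2
    have h2 := uniq_Cg m _ _ h1 hfam s hs
    have hs' := (Finset.mem_Icc.mp hs).1
    rw [← hcan2 s hs' (T' s), h2, hcan s hs']
  · have h1 : Cg 1 RR (fun n => -3 / 2 + ∑ s ∈ Finset.Icc 1 1,
        Polynomial.aeval (Real.log (Real.log n)) ((fun _ => X - C (5 / 2) : ℕ → Polynomial ℚ) s) *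
          ta n ^ s) := by
      refine (RR2.mono (show 1 ≤ 2 by norm_num)).trans ?_
      have a1 : (fun n => tt n ^ 2) =O[Filter.atTop] fun n => tt n ^ 2 :=
        Asymptotics.isBigO_refl _ _
      have a2 := ta_O_tt.mul (Asymptotics.isBigO_refl tt Filter.atTop)
      have a3 := ta_O_tt.mul ta_O_tt
      have a4 := ((a1.const_mul_left (-1 / 2)).add ((a2.congr_right
        (fun n => (sq (tt n)).symm)).const_mul_left (7 / 2))).add
        ((a3.congr_right (fun n => (sq (tt n)).symm)).const_mul_left (-29 / 4))
      refine Asymptotics.IsBigO.congr_left a4 fun n => ?_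
      simp [tt, ta]
      ring
    have h2 := uniq_Cg 1 _ _ (hexp 1 hm) h1 1 (by simp)
    simp [h2]
  · intro hm2
    have h1 : Cg 2 RR (fun n => -3 / 2 + ∑ s ∈ Finset.Icc 1 2,
        Polynomial.aeval (Real.log (Real.log n)) ((fun s => if s = 1 then X - C (5 / 2) else
          C (-1 / 2) * (X ^ 2 - C 7 * X + C (29 / 2)) : ℕ → Polynomial ℚ) s) *
          ta n ^ s) := by
      refine RR2.trans ?_
      refine Asymptotics.IsBigO.congr_left (Asymptotics.isBigO_zero _ _) fun n => ?_
      rw [show Finset.Icc 1 2 = {1, 2} by rfl]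
      simp [tt, ta, map_ofNat]
      ring
    have h2 := uniq_Cg 2 _ _ (hexp 2 hm2) h1 2 (by simp)
    simp only [h2]
    rw [if_neg (by norm_num), ← mul_assoc, ← C_mul]
    norm_num
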